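/- arXiv:2312.16543 — 5 statements merged into one kernel-verified Lean document; each statement's English description precedes it below -/
import Mathlib

section
/- Let (J, ·, α) be a finite-dimensional multiplicative Hom-Jordan superalgebra with α invertible, (V, π, β) a finite-dimensional representation with β invertible, and T : V → J an even linear map with T ∘ β = α ∘ T. Then the following are equivalent: (i) T is an O-operator of J associated to (V, π, β); (ii) T − σ(T) is a super skew-symmetric solution of the super Hom-Jordan Yang-Baxter equation in the semi-direct product Hom-Jordan superalgebra J ⋉_{π⋆} V*; (iii) T − σ(T) is an O-operator of the Hom-Jordan superalgebra J ⋉_{π⋆} V* associated to its coadjoint representation ad⋆. -/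
open scoped TensorProduct

noncomputable section

/-- The sign `(-1)^e` attached to a parity `e : ZMod 2`. -/
def gsign (K : Type*) [Field K] (e : ZMod 2) : K := (-1 : K) ^ e.val

variable {K : Type*} [Field K] [CharZero K]
variable {J V : Type*} [AddCommGroup J] [Module K J] [AddCommGroup V] [Module K V]

/-- An even bilinear map with respect to a `ZMod 2`-grading. -/
def EvenBilin (g : ZMod 2 → Submodule K J) (m : J →ₗ[K] J →ₗ[K] J) : Prop :=
  ∀ i j : ZMod 2, ∀ x ∈ g i, ∀ y ∈ g j, m x y ∈ g (i + j)

/-- An even linear map with respect to a `ZMod 2`-grading. -/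
def EvenMap (g : ZMod 2 → Submodule K J) (α : J →ₗ[K] J) : Prop :=
  ∀ i : ZMod 2, ∀ x ∈ g i, α x ∈ g i

/-- Super-commutativity `x·y = (-1)^{|x||y|} y·x` on homogeneous elements. -/
def SuperComm (g : ZMod 2 → Submodule K J) (m : J →ₗ[K] J →ₗ[K] J) : Prop :=
  ∀ i j : ZMod 2, ∀ x ∈ g i, ∀ y ∈ g j, m x y = gsign K (i * j) • m y x

/-- The Hom-associator `as_α(x,y,z) = (x·y)·α(z) − α(x)·(y·z)`. -/
def hAss (m : J →ₗ[K] J →ₗ[K] J) (α : J →ₗ[K] J) (x y z : J) : J :=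
  m (m x y) (α z) - m (α x) (m y z)

/-- The Hom-Jordan super-identity: the cyclic sum over `(x,y,u)` of
`(-1)^{|u|(|x|+|z|)} as_α(x·y, α(z), α(u))` vanishes. -/
def HomJordanId (g : ZMod 2 → Submodule K J) (m : J →ₗ[K] J →ₗ[K] J) (α : J →ₗ[K] J) : Prop :=
  ∀ px py pz pu : ZMod 2, ∀ x ∈ g px, ∀ y ∈ g py, ∀ z ∈ g pz, ∀ u ∈ g pu,
      gsign K (pu * (px + pz)) • hAss m α (m x y) (α z) (α u)
    + gsign K (px * (py + pz)) • hAss m α (m y u) (α z) (α x)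
    + gsign K (py * (pu + pz)) • hAss m α (m u x) (α z) (α y) = 0

/-- Hom-Jordan superalgebra. -/
def IsHomJordan (g : ZMod 2 → Submodule K J) (m : J →ₗ[K] J →ₗ[K] J) (α : J →ₗ[K] J) : Prop :=
  EvenBilin g m ∧ EvenMap g α ∧ SuperComm g m ∧ HomJordanId g m α

/-- `α` is multiplicative with respect to `m`. -/
def IsMult (m : J →ₗ[K] J →ₗ[K] J) (α : J →ₗ[K] J) : Prop :=
  ∀ x y : J, α (m x y) = m (α x) (α y)

/-- Multiplicative Hom-Jordan superalgebra. -/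
def IsMultHomJordan (g : ZMod 2 → Submodule K J) (m : J →ₗ[K] J →ₗ[K] J) (α : J →ₗ[K] J) :
    Prop :=
  IsHomJordan g m α ∧ IsMult m α

/-- Evenness of a representation map. -/
def EvenRepMap (g : ZMod 2 → Submodule K J) (gV : ZMod 2 → Submodule K V)
    (π : J →ₗ[K] Module.End K V) : Prop :=
  ∀ i j : ZMod 2, ∀ x ∈ g i, ∀ v ∈ gV j, π x v ∈ gV (i + j)

/-- Representation (module) of a Hom-Jordan superalgebra. -/
def IsRep (g : ZMod 2 → Submodule K J) (m : J →ₗ[K] J →ₗ[K] J) (α : J →ₗ[K] J)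
    (gV : ZMod 2 → Submodule K V) (π : J →ₗ[K] Module.End K V) (β : Module.End K V) : Prop :=
  EvenRepMap g gV π ∧ (∀ i : ZMod 2, ∀ v ∈ gV i, β v ∈ gV i) ∧
  (∀ x : J, β * π x = π (α x) * β) ∧
  (∀ px py pz : ZMod 2, ∀ x ∈ g px, ∀ y ∈ g py, ∀ z ∈ g pz,
      gsign K (px * pz) • (π (m (α x) (α y)) * π (α z) * β)
    + gsign K (px * py) • (π (m (α y) (α z)) * π (α x) * β)
    + gsign K (py * pz) • (π (m (α z) (α x)) * π (α y) * β)
    = gsign K (px * pz) • (π (α (α x)) * π (m y z) * β)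
    + gsign K (px * py) • (π (α (α y)) * π (m z x) * β)
    + gsign K (py * pz) • (π (α (α z)) * π (m x y) * β)) ∧
  (∀ px py pz : ZMod 2, ∀ x ∈ g px, ∀ y ∈ g py, ∀ z ∈ g pz,
      gsign K (px * pz) • (π (m (α x) (α y)) * π (α z) * β)
    + gsign K (px * py) • (π (m (α y) (α z)) * π (α x) * β)
    + gsign K (py * pz) • (π (m (α z) (α x)) * π (α y) * β)
    = gsign K (px * pz) • (π (α (α x)) * π (α y) * π z)
    + gsign K (px * py + py * pz) • (π (α (α z)) * π (α y) * π x)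
    + gsign K (py * pz + px * pz) • (π (m (m x z) (α y)) * (β * β)))

/-- O-operator on `J` associated to the representation `(V, π, β)`. -/
def IsOOperator (g : ZMod 2 → Submodule K J) (m : J →ₗ[K] J →ₗ[K] J) (α : J →ₗ[K] J)
    (gV : ZMod 2 → Submodule K V) (π : J →ₗ[K] Module.End K V) (β : Module.End K V)
    (T : V →ₗ[K] J) : Prop :=
  (∀ i : ZMod 2, ∀ v ∈ gV i, T v ∈ g i) ∧
  (∀ v : V, α (T v) = T (β v)) ∧
  (∀ i j : ZMod 2, ∀ u ∈ gV i, ∀ v ∈ gV j,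
    m (T u) (T v) = T (π (T u) v + gsign K (i * j) • π (T v) u))

/-- The grading on a direct sum `J ⊕ V`. -/
def prodGrading (g : ZMod 2 → Submodule K J) (gV : ZMod 2 → Submodule K V) :
    ZMod 2 → Submodule K (J × V) := fun i => (g i).prod (gV i)

/-- The semidirect product multiplication, determined on homogeneous elements. -/
def IsSemidirectMul (g : ZMod 2 → Submodule K J) (gV : ZMod 2 → Submodule K V)
    (m : J →ₗ[K] J →ₗ[K] J) (π : J →ₗ[K] Module.End K V)
    (m' : (J × V) →ₗ[K] (J × V) →ₗ[K] (J × V)) : Prop :=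
  ∀ i j : ZMod 2, ∀ x ∈ g i, ∀ u ∈ gV i, ∀ y ∈ g j, ∀ v ∈ gV j,
    m' (x, u) (y, v) = (m x y, π x v + gsign K (i * j) • π y u)

/-- The induced grading on the linear dual. -/
def dualGrading (gV : ZMod 2 → Submodule K V) (i : ZMod 2) :
    Submodule K (Module.Dual K V) where
  carrier := {ξ | ∀ x ∈ gV (i + 1), ξ x = 0}
  add_mem' := by
    intro a b ha hb x hx
    simp [ha x hx, hb x hx]
  zero_mem' := by
    intro x hx
    simp
  smul_mem' := by
    intro c a ha x hx
    simp [ha x hx]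

/-- Nijenhuis operator on a Hom-Jordan superalgebra. -/
def IsNijenhuis (gA : ZMod 2 → Submodule K J) (mA : J →ₗ[K] J →ₗ[K] J)
    (γ N : J →ₗ[K] J) : Prop :=
  EvenMap gA N ∧ N ∘ₗ γ = γ ∘ₗ N ∧
  ∀ x y : J, mA (N x) (N y) = N (mA (N x) y + mA x (N y) - N (mA x y))

/-- The super-symmetrized product `x·y = x∘y + (-1)^{|x||y|} y∘x` on homogeneous
elements of parities `i`, `j`. -/
def sMul (c : J →ₗ[K] J →ₗ[K] J) (i j : ZMod 2) (x y : J) : J :=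
  c x y + gsign K (i * j) • c y x

/-- Hom-pre-Jordan superalgebra. -/
def IsHomPreJordan (g : ZMod 2 → Submodule K J) (c : J →ₗ[K] J →ₗ[K] J) (α : J →ₗ[K] J) :
    Prop :=
  EvenBilin g c ∧ EvenMap g α ∧ IsMult c α ∧
  (∀ px py pz pu : ZMod 2, ∀ x ∈ g px, ∀ y ∈ g py, ∀ z ∈ g pz, ∀ u ∈ g pu,
      c (sMul c px py (α x) (α y)) (c (α z) (α u))
    + gsign K (px * (py + pz)) • c (sMul c py pz (α y) (α z)) (c (α x) (α u))
    + gsign K (pz * (px + py)) • c (sMul c pz px (α z) (α x)) (c (α y) (α u))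
    = c (α (α x)) (c (sMul c py pz y z) (α u))
    + gsign K (px * (py + pz)) • c (α (α y)) (c (sMul c pz px z x) (α u))
    + gsign K (pz * (px + py)) • c (α (α z)) (c (sMul c px py x y) (α u))) ∧
  (∀ px py pz pu : ZMod 2, ∀ x ∈ g px, ∀ y ∈ g py, ∀ z ∈ g pz, ∀ u ∈ g pu,
      c (α (α x)) (c (α y) (c z u))
    + gsign K (pz * (px + py) + px * py) • c (α (α z)) (c (α y) (c x u))
    + gsign K (py * pz) • c (sMul c (px + pz) py (sMul c px pz x z) (α y)) (α (α u))
    = c (α (α x)) (c (sMul c py pz y z) (α u))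
    + gsign K (px * (py + pz)) • c (α (α y)) (c (sMul c pz px z x) (α u))
    + gsign K (pz * (px + py)) • c (α (α z)) (c (sMul c px py x y) (α u)))

/-- Hom-dendriform superalgebra, with `p = ≺` and `s = ≻`. -/
def IsHomDendriform (g : ZMod 2 → Submodule K J)
    (p s : J →ₗ[K] J →ₗ[K] J) (α : J →ₗ[K] J) : Prop :=
  EvenBilin g p ∧ EvenBilin g s ∧ EvenMap g α ∧ IsMult p α ∧ IsMult s α ∧
  (∀ x y z : J, s (α x) (s y z) = s (p x y + s x y) (α z)) ∧
  (∀ x y z : J, p (p x y) (α z) = p (α x) (p y z + s y z)) ∧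
  (∀ x y z : J, p (s x y) (α z) = s (α x) (p y z))

/-- Hom-alternative superalgebra. -/
def IsHomAlternative (g : ZMod 2 → Submodule K J) (m : J →ₗ[K] J →ₗ[K] J)
    (α : J →ₗ[K] J) : Prop :=
  EvenBilin g m ∧ EvenMap g α ∧
  (∀ i j : ZMod 2, ∀ x ∈ g i, ∀ y ∈ g j, ∀ z : J,
    hAss m α x y z = -(gsign K (i * j) • hAss m α y x z)) ∧
  (∀ j k : ZMod 2, ∀ y ∈ g j, ∀ z ∈ g k, ∀ x : J,
    hAss m α x y z = -(gsign K (j * k) • hAss m α x z y))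

/-- `ass_l` for a Hom-pre-alternative superalgebra, `p = ≺`, `s = ≻`. -/
def passL (p s : J →ₗ[K] J →ₗ[K] J) (α : J →ₗ[K] J) (x y z : J) : J :=
  s (p x y + s x y) (α z) - s (α x) (s y z)

/-- `ass_m` for a Hom-pre-alternative superalgebra. -/
def passM (p s : J →ₗ[K] J →ₗ[K] J) (α : J →ₗ[K] J) (x y z : J) : J :=
  p (s x y) (α z) - s (α x) (p y z)

/-- `ass_r` for a Hom-pre-alternative superalgebra. -/
def passR (p s : J →ₗ[K] J →ₗ[K] J) (α : J →ₗ[K] J) (x y z : J) : J :=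
  p (p x y) (α z) - p (α x) (p y z + s y z)

/-- Hom-pre-alternative superalgebra. -/
def IsHomPreAlternative (g : ZMod 2 → Submodule K J)
    (p s : J →ₗ[K] J →ₗ[K] J) (α : J →ₗ[K] J) : Prop :=
  EvenBilin g p ∧ EvenBilin g s ∧ EvenMap g α ∧
  (∀ i j : ZMod 2, ∀ x ∈ g i, ∀ y ∈ g j, ∀ z : J,
    passM p s α x y z + gsign K (i * j) • passR p s α y x z = 0) ∧
  (∀ j k : ZMod 2, ∀ y ∈ g j, ∀ z ∈ g k, ∀ x : J,
    passM p s α x y z + gsign K (j * k) • passL p s α x z y = 0) ∧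
  (∀ i j : ZMod 2, ∀ x ∈ g i, ∀ y ∈ g j, ∀ z : J,
    passL p s α x y z + gsign K (i * j) • passL p s α y x z = 0) ∧
  (∀ j k : ZMod 2, ∀ y ∈ g j, ∀ z ∈ g k, ∀ x : J,
    passR p s α x y z + gsign K (j * k) • passR p s α x z y = 0)

/-- `r = Σ Xₗ ⊗ Yₗ` (with `Xₗ, Yₗ` homogeneous of parities `Pₗ, Qₗ`) is
super skew-symmetric: `σ(r) = -r`. -/
def SkewSol {ι : Type*} [Fintype ι] {A : Type*} [AddCommGroup A] [Module K A]
    (X Y : ι → A) (P Q : ι → ZMod 2) : Prop :=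
  (∑ l, gsign K (P l * Q l) • (Y l ⊗ₜ[K] X l)) = -(∑ l, X l ⊗ₜ[K] Y l)

/-- `r = Σ Xₗ ⊗ Yₗ` solves the super Hom-Jordan Yang-Baxter equation
`r₁₂·r₁₃ − r₁₂·r₂₃ + r₁₃·r₂₃ = 0`. -/
def YBESol {ι : Type*} [Fintype ι] {A : Type*} [AddCommGroup A] [Module K A]
    (mA : A →ₗ[K] A →ₗ[K] A) (γ : A →ₗ[K] A) (X Y : ι → A) (P Q : ι → ZMod 2) : Prop :=
  (∑ l, ∑ l', gsign K (P l' * Q l) • ((mA (X l) (X l') ⊗ₜ[K] γ (Y l)) ⊗ₜ[K] γ (Y l')))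
    - (∑ l, ∑ l', (γ (X l) ⊗ₜ[K] mA (Y l) (X l')) ⊗ₜ[K] γ (Y l'))
    + (∑ l, ∑ l', gsign K (P l' * Q l) • ((γ (X l) ⊗ₜ[K] γ (X l')) ⊗ₜ[K] mA (Y l) (Y l')))
    = 0

/-- The left components of the family representing `r = T − σ(T)` in
`(J ⋉ V*) ⊗ (J ⋉ V*)`, for `T` regarded in `J ⊗ V*` via a homogeneous basis. -/
def rX {n : ℕ} (T : V →ₗ[K] J) (b : Module.Basis (Fin n) K V) (pe : Fin n → ZMod 2) :
    Fin n ⊕ Fin n → J × Module.Dual K V :=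
  Sum.elim (fun k => (T (b k), 0))
    (fun k => -(gsign K (pe k * pe k)) • ((0 : J), b.coord k))

/-- The right components of the family representing `r = T − σ(T)`. -/
def rY {n : ℕ} (T : V →ₗ[K] J) (b : Module.Basis (Fin n) K V) :
    Fin n ⊕ Fin n → J × Module.Dual K V :=
  Sum.elim (fun k => ((0 : J), b.coord k)) (fun k => (T (b k), 0))

/-- The parities of the family representing `r = T − σ(T)`. -/
def rP {n : ℕ} (pe : Fin n → ZMod 2) : Fin n ⊕ Fin n → ZMod 2 := Sum.elim pe pe
set_option linter.unusedSectionVars false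
set_option linter.all false
namespace OOp

lemma gs0 : gsign K 0 = 1 := by simp [gsign]
lemma gs1 : gsign K 1 = -1 := by simp [gsign, ZMod.val_one]
lemma z2 (p : ZMod 2) : p = 0 ∨ p = 1 := by revert p; decide
lemma z11 : (1 + 1 : ZMod 2) = 0 := by decide
lemma gs_comm (p q : ZMod 2) : gsign K (p * q) = gsign K (q * p) := by rw [mul_comm]
lemma gs_sq (p : ZMod 2) : gsign K p * gsign K p = 1 := by
  rcases z2 p with rfl | rfl <;> simp [gs0, gs1]
lemma ne_add (p q : ZMod 2) (h : p ≠ q) : q = p + 1 := by revert p q; decide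

lemma exists_proj (g : ZMod 2 → Submodule K J) (hg : DirectSum.IsInternal g) :
    ∃ P : ZMod 2 → J →ₗ[K] J, (∀ i x, P i x ∈ g i) ∧ (∀ i, ∀ x ∈ g i, P i x = x) ∧
      (∀ i, ∀ x ∈ g (i + 1), P i x = 0) ∧ ∀ x, P 0 x + P 1 x = x := by
  classical
  let _ := hg.chooseDecomposition
  refine ⟨fun i => (g i).subtype ∘ₗ DirectSum.component K _ _ i ∘ₗ
    (DirectSum.decomposeLinearEquiv g).toLinearMap, ?_, ?_, ?_, ?_⟩
  · intro i x
    exact Submodule.coe_mem _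
  · intro i x hx
    exact DirectSum.decompose_of_mem_same g hx
  · intro i x hx
    refine DirectSum.decompose_of_mem_ne g hx ?_
    clear hx; revert i; decide
  · intro x
    have h := DirectSum.sum_support_decompose g x
    rw [Finset.sum_subset (Finset.subset_univ _) (by
      intro i _ hi
      simpa using hi)] at h
    rw [show (Finset.univ : Finset (ZMod 2)) = {0, 1} from rfl,
      Finset.sum_pair (by decide)] at h
    exact h

lemma symm_even (g : ZMod 2 → Submodule K J) (hg : DirectSum.IsInternal g) (α : J ≃ₗ[K] J)
    (hα : ∀ i, ∀ x ∈ g i, α x ∈ g i) : ∀ i, ∀ x ∈ g i, α.symm x ∈ g i := by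
  obtain ⟨P, h1, h2, h3, h4⟩ := exists_proj g hg
  have hP : ∀ x, ∀ i, P i x + P (i + 1) x = x := by
    intro x i
    rcases z2 i with rfl | rfl
    · simpa using h4 x
    · rw [z11, add_comm]; exact h4 x
  intro i x hx
  have e := hP (α.symm x) i
  have e2 : P (i + 1) (α.symm x) = 0 := by
    apply α.injective
    have h5 : α (P i (α.symm x)) + α (P (i + 1) (α.symm x)) = x := by
      rw [← map_add, e, α.apply_symm_apply]
    have h6 := congrArg (P (i + 1)) h5
    rw [map_add, h3 (i + 1) (α _) (hα _ _ (by
      have := h1 i (α.symm x)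
      rwa [add_assoc, z11, add_zero])), h2 _ _ (hα _ _ (h1 _ _)),
      h3 (i + 1) x (by rwa [add_assoc, z11, add_zero])] at h6
    simpa using h6
  rw [e2, add_zero] at e
  rw [← e]; exact h1 _ _

lemma coord_mem {n : ℕ} (gV : ZMod 2 → Submodule K V) (hgV : DirectSum.IsInternal gV)
    (b : Module.Basis (Fin n) K V) (pe : Fin n → ZMod 2) (hb : ∀ k, b k ∈ gV (pe k)) (k : Fin n) :
    b.coord k ∈ dualGrading gV (pe k) := by
  obtain ⟨P, h1, h2, h3, h4⟩ := exists_proj gV hgV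
  intro x hx
  have e : x = ∑ j, b.repr x j • P (pe k + 1) (b j) := by
    have := congrArg (P (pe k + 1)) (b.sum_repr x)
    rw [h2 _ x hx, map_sum] at this
    conv_lhs => rw [← this]
    simp
  rw [e, map_sum]
  refine Finset.sum_eq_zero fun j _ => ?_
  by_cases hj : pe k = pe j
  · rw [h3 _ (b j) (by rw [add_assoc, z11, add_zero, hj]; exact hb j)]; simp
  · rw [h2 _ (b j) (by rw [← ne_add _ _ hj]; exact hb j)]
    have : j ≠ k := by rintro rfl; exact hj rfl
    simp [this]

lemma functional_sep (g : ZMod 2 → Submodule K J) (hg : DirectSum.IsInternal g) (x y : J)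
    (h : ∀ i, ∀ φ ∈ dualGrading g i, φ x = φ y) : x = y := by
  obtain ⟨P, h1, h2, h3, h4⟩ := exists_proj g hg
  have key : ∀ φ : Module.Dual K J, φ x = φ y := by
    intro φ
    rw [← h4 x, ← h4 y, map_add, map_add]
    have := h 0 (φ ∘ₗ P 0) (by intro z hz; simp [h3 _ _ hz])
    have := h 1 (φ ∘ₗ P 1) (by intro z hz; simp [h3 _ _ hz])
    simp_all
  rw [← sub_eq_zero, ← Module.forall_dual_apply_eq_zero_iff K]
  intro φ; rw [map_sub, key, sub_self]


lemma coord_zero {n : ℕ} (gV : ZMod 2 → Submodule K V) (hgV : DirectSum.IsInternal gV)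
    (b : Module.Basis (Fin n) K V) (pe : Fin n → ZMod 2) (hb : ∀ k, b k ∈ gV (pe k)) (k : Fin n)
    (q : ZMod 2) (v : V) (hv : v ∈ gV q) (h : pe k ≠ q) : b.coord k v = 0 :=
  coord_mem gV hgV b pe hb k v (by rw [← ne_add _ _ h]; exact hv)

/-- replace a parity-dependent sign in a coordinate expression -/
lemma coord_sign {n : ℕ} (gV : ZMod 2 → Submodule K V) (hgV : DirectSum.IsInternal gV)
    (b : Module.Basis (Fin n) K V) (pe : Fin n → ZMod 2) (hb : ∀ k, b k ∈ gV (pe k)) (k : Fin n)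
    (q : ZMod 2) (v : V) (hv : v ∈ gV q) (ε : ZMod 2 → K) :
    ε (pe k) * b.coord k v = ε q * b.coord k v := by
  by_cases h : pe k = q
  · rw [h]
  · rw [coord_zero gV hgV b pe hb k q v hv h]; simp

lemma dual_sign (gV : ZMod 2 → Submodule K V) (p q : ZMod 2) (φ : Module.Dual K V)
    (hφ : φ ∈ dualGrading gV p) (v : V) (hv : v ∈ gV q) (ε : ZMod 2 → K) :
    ε p * φ v = ε q * φ v := by
  by_cases h : p = q
  · rw [h]
  · rw [hφ v (by rw [← ne_add _ _ h]; exact hv)]; simp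

lemma L1 {n : ℕ} {M : Type*} [AddCommGroup M] [Module K M]
    (g : ZMod 2 → Submodule K J) (α : J ≃ₗ[K] J)
    (gV : ZMod 2 → Submodule K V) (hgV : DirectSum.IsInternal gV)
    (π : J →ₗ[K] Module.End K V) (β : V ≃ₗ[K] V)
    (hαs : ∀ i, ∀ x ∈ g i, α.symm x ∈ g i) (hβs : ∀ i, ∀ x ∈ gV i, β.symm x ∈ gV i)
    (hπe : EvenRepMap g gV π) (hπβ : ∀ x v, β (π x v) = π (α x) (β v))
    (πs : J →ₗ[K] Module.End K (Module.Dual K V))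
    (hπs : ∀ i j : ZMod 2, ∀ x ∈ g i, ∀ ξ ∈ dualGrading gV j, ∀ u : V,
      πs x ξ u = gsign K (i * j) * ξ (π (α.symm x) (β.symm (β.symm u))))
    (T : V →ₗ[K] J)
    (hTβ : ∀ v : V, T (β v) = α (T v))
    (b : Module.Basis (Fin n) K V) (pe : Fin n → ZMod 2)
    (hb : ∀ k, b k ∈ gV (pe k))
    (F : J →ₗ[K] Module.Dual K V →ₗ[K] M) (p : ZMod 2) (x : J) (hx : x ∈ g p)
    (ε : ZMod 2 → K) :
    ∑ k, ε (pe k) • F (α (T (b k))) (πs x (b.coord k)) =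
      ∑ j, (ε (p + pe j) * gsign K (p * (p + pe j))) •
        F (T (π x (b j))) (b.coord j ∘ₗ β.symm.toLinearMap) := by
  have e1 : ∀ k, πs x (b.coord k) = ∑ j, (gsign K (p * pe k) *
      b.coord k (π (α.symm x) (β.symm (b j)))) • (b.coord j ∘ₗ β.symm.toLinearMap) := by
    intro k
    refine (b.map β).ext fun j => ?_
    rw [hπs p (pe k) x hx _ (coord_mem gV hgV b pe hb k)]
    simp [Finsupp.single_apply]
  have e2 : ∀ k, ε (pe k) • F (α (T (b k))) (πs x (b.coord k)) = ∑ j,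
      (ε (p + pe j) * gsign K (p * (p + pe j))) •
        (b.coord k (π (α.symm x) (β.symm (b j))) •
          F (α (T (b k))) (b.coord j ∘ₗ β.symm.toLinearMap)) := by
    intro k
    rw [e1, map_sum, Finset.smul_sum]
    refine Finset.sum_congr rfl fun j _ => ?_
    rw [map_smul, smul_smul, smul_smul, ← mul_assoc]
    congr 1
    exact coord_sign gV hgV b pe hb k (p + pe j) _
      (hπe _ _ _ (hαs _ _ hx) _ (hβs _ _ (hb j))) (fun q => ε q * gsign K (p * q))
  simp_rw [e2]
  rw [Finset.sum_comm]
  refine Finset.sum_congr rfl fun j _ => ?_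
  rw [← Finset.smul_sum]
  congr 1
  have e3 : T (π x (b j)) =
      ∑ k, b.coord k (π (α.symm x) (β.symm (b j))) • α (T (b k)) := by
    have h1 : π x (b j) = β (π (α.symm x) (β.symm (b j))) := by rw [hπβ]; simp
    rw [h1, hTβ]
    conv_lhs => rw [← b.sum_repr (π (α.symm x) (β.symm (b j)))]
    simp [-Module.Basis.sum_repr]
  rw [e3, map_sum, LinearMap.sum_apply]
  simp

/-- the defect of the O-operator identity on the basis -/
def defect {n : ℕ} (m : J →ₗ[K] J →ₗ[K] J) (π : J →ₗ[K] Module.End K V)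
    (T : V →ₗ[K] J) (b : Module.Basis (Fin n) K V) (pe : Fin n → ZMod 2) (k l : Fin n) : J :=
  m (T (b k)) (T (b l)) - T (π (T (b k)) (b l)) - gsign K (pe k * pe l) • T (π (T (b l)) (b k))

lemma oop_iff {n : ℕ} 
    (g : ZMod 2 → Submodule K J) (α : J ≃ₗ[K] J) (m : J →ₗ[K] J →ₗ[K] J)
    (gV : ZMod 2 → Submodule K V) (hgV : DirectSum.IsInternal gV)
    (π : J →ₗ[K] Module.End K V) (β : V ≃ₗ[K] V)
    (T : V →ₗ[K] J) (hTe : ∀ i : ZMod 2, ∀ v ∈ gV i, T v ∈ g i)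
    (hTβ : ∀ v : V, T (β v) = α (T v))
    (b : Module.Basis (Fin n) K V) (pe : Fin n → ZMod 2)
    (hb : ∀ k, b k ∈ gV (pe k)) :
    IsOOperator g m α.toLinearMap gV π β.toLinearMap T ↔
      ∀ k l, defect m π T b pe k l = 0 := by
  constructor
  · rintro ⟨-, -, h⟩ k l
    have := h _ _ _ (hb k) _ (hb l)
    rw [defect, this, map_add, map_smul]; abel
  · intro h
    refine ⟨hTe, fun v => (hTβ v).symm, ?_⟩
    intro i j u hu v hv
    have h' : ∀ k l, m (T (b k)) (T (b l)) = T (π (T (b k)) (b l)) +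
        gsign K (pe k * pe l) • T (π (T (b l)) (b k)) := by
      intro k l
      have := h k l
      rw [defect, sub_sub, sub_eq_zero] at this
      exact this
    have L : m (T u) (T v) = ∑ k, ∑ l, (b.coord k u * b.coord l v) • m (T (b k)) (T (b l)) := by
      conv_lhs => rw [← b.sum_repr u, ← b.sum_repr v]
      simp [-Module.Basis.sum_repr, Finset.smul_sum, smul_smul]
      rw [Finset.sum_comm]; simp only [mul_comm]
    have R1 : T (π (T u) v) = ∑ k, ∑ l, (b.coord k u * b.coord l v) • T (π (T (b k)) (b l)) := by
      conv_lhs => rw [← b.sum_repr u, ← b.sum_repr v]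
      simp [-Module.Basis.sum_repr, Finset.smul_sum, smul_smul]
      rw [Finset.sum_comm]; simp only [mul_comm]
    have R2 : T (π (T v) u) = ∑ k, ∑ l, (b.coord k u * b.coord l v) • T (π (T (b l)) (b k)) := by
      conv_lhs => rw [← b.sum_repr u, ← b.sum_repr v]
      simp [-Module.Basis.sum_repr, Finset.smul_sum, smul_smul, mul_comm]
    rw [map_add, map_smul, L, R1, R2, Finset.smul_sum, ← Finset.sum_add_distrib]
    refine Finset.sum_congr rfl fun k _ => ?_
    rw [Finset.smul_sum, ← Finset.sum_add_distrib]
    refine Finset.sum_congr rfl fun l _ => ?_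
    rw [h', smul_add, smul_smul, smul_smul]
    congr 2
    have e1 := coord_sign gV hgV b pe hb k i u hu (fun q => gsign K (q * pe l))
    have e2 := coord_sign gV hgV b pe hb l j v hv (fun q => gsign K (i * q))
    calc b.coord k u * b.coord l v * gsign K (pe k * pe l)
        = (gsign K (pe k * pe l) * b.coord k u) * b.coord l v := by ring
      _ = (gsign K (i * pe l) * b.coord l v) * b.coord k u := by rw [e1]; ring
      _ = _ := by rw [e2]; ring


lemma ybe_id {n : ℕ} {A : Type*} [AddCommGroup A] [Module K A]
    (g : ZMod 2 → Submodule K J) (α : J ≃ₗ[K] J) (m : J →ₗ[K] J →ₗ[K] J)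
    (gV : ZMod 2 → Submodule K V) (hgV : DirectSum.IsInternal gV)
    (π : J →ₗ[K] Module.End K V) (β : V ≃ₗ[K] V)
    (hαs : ∀ i, ∀ x ∈ g i, α.symm x ∈ g i) (hβs : ∀ i, ∀ x ∈ gV i, β.symm x ∈ gV i)
    (hπe : EvenRepMap g gV π) (hπβ : ∀ x v, β (π x v) = π (α x) (β v))
    (πs : J →ₗ[K] Module.End K (Module.Dual K V))
    (hπs : ∀ i j : ZMod 2, ∀ x ∈ g i, ∀ ξ ∈ dualGrading gV j, ∀ u : V,
      πs x ξ u = gsign K (i * j) * ξ (π (α.symm x) (β.symm (β.symm u))))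
    (m' : A →ₗ[K] A →ₗ[K] A)
    (T : V →ₗ[K] J) (hTe : ∀ i : ZMod 2, ∀ v ∈ gV i, T v ∈ g i)
    (hTβ : ∀ v : V, T (β v) = α (T v))
    (b : Module.Basis (Fin n) K V) (pe : Fin n → ZMod 2)
    (hb : ∀ k, b k ∈ gV (pe k))
    (γ : A →ₗ[K] A)
    (I : J →ₗ[K] A) (N : Module.Dual K V →ₗ[K] A)
    (η : Fin n → Module.Dual K V) (hη : ∀ k, η k = b.coord k ∘ₗ β.symm.toLinearMap)
    (mJJ : ∀ k l, m' (I (T (b k))) (I (T (b l))) = I (m (T (b k)) (T (b l))))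
    (mJV : ∀ k l, m' (I (T (b k))) (N (b.coord l)) = N (πs (T (b k)) (b.coord l)))
    (mVJ : ∀ k l, m' (N (b.coord k)) (I (T (b l))) =
      gsign K (pe k * pe l) • N (πs (T (b l)) (b.coord k)))
    (mVV : ∀ k l, m' (N (b.coord k)) (N (b.coord l)) = 0)
    (gJ : ∀ x, γ (I x) = I (α x))
    (gV' : ∀ k, γ (N (b.coord k)) = N (η k))
    (X Y : Fin n ⊕ Fin n → A) (P : Fin n ⊕ Fin n → ZMod 2)
    (x1 : ∀ k, X (Sum.inl k) = I (T (b k)))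
    (x2 : ∀ k, X (Sum.inr k) = -(gsign K (pe k * pe k)) • N (b.coord k))
    (y1 : ∀ k, Y (Sum.inl k) = N (b.coord k))
    (y2 : ∀ k, Y (Sum.inr k) = I (T (b k)))
    (p1 : ∀ k, P (Sum.inl k) = pe k)
    (p2 : ∀ k, P (Sum.inr k) = pe k) :
    (∑ l, ∑ l', gsign K (P l' * P l) • ((m' (X l) (X l') ⊗ₜ[K] γ (Y l)) ⊗ₜ[K] γ (Y l')))
    - (∑ l, ∑ l', (γ (X l) ⊗ₜ[K] m' (Y l) (X l')) ⊗ₜ[K] γ (Y l'))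
    + (∑ l, ∑ l', gsign K (P l' * P l) • ((γ (X l) ⊗ₜ[K] γ (X l')) ⊗ₜ[K] m' (Y l) (Y l')))
    = ∑ k, ∑ l, (gsign K (pe k * pe l) • ((I (defect m π T b pe k l) ⊗ₜ[K] N (η k)) ⊗ₜ[K] N (η l))
      + gsign K (pe k) • ((N (η k) ⊗ₜ[K] I (defect m π T b pe k l)) ⊗ₜ[K] N (η l))
      + gsign K (pe k + pe l + pe k * pe l) •
        ((N (η k) ⊗ₜ[K] N (η l)) ⊗ₜ[K] I (defect m π T b pe k l))) := by
  have hc := coord_mem gV hgV b pe hb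
  have hT : ∀ k, T (b k) ∈ g (pe k) := fun k => hTe _ _ (hb k)
  have LL := fun (F : J →ₗ[K] Module.Dual K V →ₗ[K] ((A ⊗[K] A) ⊗[K] A)) l ε =>
    L1 g α gV hgV π β hαs hβs hπe hπβ πs hπs T hTβ b pe hb F (pe l) (T (b l)) (hT l) ε
  simp_rw [← hη] at LL
  have P12 := fun c => LL (((TensorProduct.mk K _ _).compl₁₂ I N).compr₂
    ((TensorProduct.mk K _ _).flip c))
  have P13 := fun c => LL ((TensorProduct.mk K _ _).compl₁₂
    ((TensorProduct.mk K _ _).flip c ∘ₗ I) N)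
  have P21 := fun c => LL (((TensorProduct.mk K _ _).flip.compl₁₂ I N).compr₂
    ((TensorProduct.mk K _ _).flip c))
  have P31 := fun c => LL ((TensorProduct.mk K _ _).flip.compl₁₂ I
    ((TensorProduct.mk K _ _).flip c ∘ₗ N))
  have P23 := fun c => LL ((TensorProduct.mk K _ _).compl₁₂
    ((TensorProduct.mk K _ _) c ∘ₗ I) N)
  have P32 := fun c => LL ((TensorProduct.mk K _ _).flip.compl₁₂ I
    ((TensorProduct.mk K _ _) c ∘ₗ N))
  simp only [LinearMap.compr₂_apply, LinearMap.compl₁₂_apply, LinearMap.flip_apply,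
    TensorProduct.mk_apply, LinearMap.comp_apply] at P12 P13 P21 P31 P23 P32
  clear LL
  simp only [Fintype.sum_sum_type, x1, x2, y1, y2, p1, p2, map_smul, LinearMap.smul_apply,
    mJJ, mJV, mVJ, mVV, gJ, gV', ← TensorProduct.smul_tmul', TensorProduct.tmul_smul,
    TensorProduct.zero_tmul, TensorProduct.tmul_zero, smul_zero, smul_smul, add_zero, zero_add,
    Finset.sum_const_zero, Finset.sum_add_distrib]
  have Q21 : ∑ x, ∑ y, (gsign K (pe y * pe x) * (-gsign K (pe x * pe x) * gsign K (pe x * pe y))) •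
        ((N (πs (T (b y)) (b.coord x)) ⊗ₜ[K] I (α (T (b x)))) ⊗ₜ[K] N (η y)) =
      ∑ k, ∑ l, -gsign K (pe k + pe k * pe l) •
        ((N (η k) ⊗ₜ[K] I (T (π (T (b l)) (b k)))) ⊗ₜ[K] N (η l)) := by
    rw [Finset.sum_comm]
    refine (Finset.sum_congr rfl fun y _ => P21 (N (η y)) y (fun q => gsign K (pe y * q) *
      (-gsign K (q * q) * gsign K (q * pe y)))).trans ?_
    rw [Finset.sum_comm]
    refine Finset.sum_congr rfl fun k _ => Finset.sum_congr rfl fun l _ => ?_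
    congr 1
    generalize pe k = p
    generalize pe l = q
    rcases z2 p with rfl | rfl <;> rcases z2 q with rfl | rfl <;> simp [gs0, gs1, z11]
  have Q31 : ∑ x, ∑ y, (gsign K (pe y * pe x) * -gsign K (pe y * pe y)) •
        ((N (πs (T (b x)) (b.coord y)) ⊗ₜ[K] N (η x)) ⊗ₜ[K] I (α (T (b y)))) =
      ∑ k, ∑ l, -gsign K (pe k + pe l) •
        ((N (η k) ⊗ₜ[K] N (η l)) ⊗ₜ[K] I (T (π (T (b l)) (b k)))) := by
    refine (Finset.sum_congr rfl fun y _ => P31 (N (η y)) y (fun q => gsign K (q * pe y) *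
      -gsign K (q * q))).trans ?_
    rw [Finset.sum_comm]
    refine Finset.sum_congr rfl fun k _ => Finset.sum_congr rfl fun l _ => ?_
    congr 1
    generalize pe k = p
    generalize pe l = q
    rcases z2 p with rfl | rfl <;> rcases z2 q with rfl | rfl <;> simp [gs0, gs1, z11]
  have Q12 : ∑ x, ∑ y, gsign K (pe x * pe y) •
        ((I (α (T (b x))) ⊗ₜ[K] N (πs (T (b y)) (b.coord x))) ⊗ₜ[K] N (η y)) =
      ∑ k, ∑ l, (1 : K) •
        ((I (T (π (T (b l)) (b k))) ⊗ₜ[K] N (η k)) ⊗ₜ[K] N (η l)) := by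
    rw [Finset.sum_comm]
    refine (Finset.sum_congr rfl fun y _ => P12 (N (η y)) y (fun q => gsign K (q * pe y))).trans ?_
    rw [Finset.sum_comm]
    refine Finset.sum_congr rfl fun k _ => Finset.sum_congr rfl fun l _ => ?_
    congr 1
    generalize pe k = p
    generalize pe l = q
    rcases z2 p with rfl | rfl <;> rcases z2 q with rfl | rfl <;> simp [gs0, gs1, z11]
  have Q32 : ∑ x, ∑ y, (-gsign K (pe y * pe y) * -gsign K (pe x * pe x)) •
        ((N (η x) ⊗ₜ[K] N (πs (T (b x)) (b.coord y))) ⊗ₜ[K] I (α (T (b y)))) =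
      ∑ k, ∑ l, gsign K (pe k + pe l + pe k * pe l) •
        ((N (η k) ⊗ₜ[K] N (η l)) ⊗ₜ[K] I (T (π (T (b k)) (b l)))) := by
    refine (Finset.sum_congr rfl fun y _ => P32 (N (η y)) y (fun q => -gsign K (q * q) *
      -gsign K (pe y * pe y))).trans ?_
    refine Finset.sum_congr rfl fun k _ => Finset.sum_congr rfl fun l _ => ?_
    congr 1
    generalize pe k = p
    generalize pe l = q
    rcases z2 p with rfl | rfl <;> rcases z2 q with rfl | rfl <;> simp [gs0, gs1, z11]
  have Q23 : ∑ x, ∑ y, (gsign K (pe y * pe x) * -gsign K (pe x * pe x)) •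
        ((N (η x) ⊗ₜ[K] I (α (T (b y)))) ⊗ₜ[K] N (πs (T (b x)) (b.coord y))) =
      ∑ k, ∑ l, -gsign K (pe k) •
        ((N (η k) ⊗ₜ[K] I (T (π (T (b k)) (b l)))) ⊗ₜ[K] N (η l)) := by
    refine (Finset.sum_congr rfl fun y _ => P23 (N (η y)) y (fun q => gsign K (q * pe y) *
      -gsign K (pe y * pe y))).trans ?_
    refine Finset.sum_congr rfl fun k _ => Finset.sum_congr rfl fun l _ => ?_
    congr 1
    generalize pe k = p
    generalize pe l = q
    rcases z2 p with rfl | rfl <;> rcases z2 q with rfl | rfl <;> simp [gs0, gs1, z11]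
  have Q13 : ∑ x, ∑ y, (gsign K (pe y * pe x) * -gsign K (pe y * pe y) * gsign K (pe x * pe y)) •
        ((I (α (T (b x))) ⊗ₜ[K] N (η y)) ⊗ₜ[K] N (πs (T (b y)) (b.coord x))) =
      ∑ k, ∑ l, -gsign K (pe k * pe l) •
        ((I (T (π (T (b k)) (b l))) ⊗ₜ[K] N (η k)) ⊗ₜ[K] N (η l)) := by
    rw [Finset.sum_comm]
    refine (Finset.sum_congr rfl fun y _ => P13 (N (η y)) y (fun q => gsign K (pe y * q) *
      -gsign K (pe y * pe y) * gsign K (q * pe y))).trans ?_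
    refine Finset.sum_congr rfl fun k _ => Finset.sum_congr rfl fun l _ => ?_
    congr 1
    generalize pe k = p
    generalize pe l = q
    rcases z2 p with rfl | rfl <;> rcases z2 q with rfl | rfl <;> simp [gs0, gs1, z11]
  rw [Q21, Q31, Q12, Q32, Q23, Q13]
  simp only [← Finset.sum_add_distrib, ← Finset.sum_sub_distrib]
  refine Finset.sum_congr rfl fun k _ => Finset.sum_congr rfl fun l _ => ?_
  simp only [defect, map_sub, map_smul, TensorProduct.sub_tmul, TensorProduct.tmul_sub,
    ← TensorProduct.smul_tmul', TensorProduct.tmul_smul]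
  generalize pe k = p
  generalize pe l = q
  rcases z2 p with rfl | rfl <;> rcases z2 q with rfl | rfl <;>
    simp only [gs0, gs1, z11, mul_zero, zero_mul, mul_one, add_zero, zero_add] <;> module

lemma skew {n : ℕ} {A : Type*} [AddCommGroup A] [Module K A] (pe : Fin n → ZMod 2)
    (x y : Fin n → A) (X Y : Fin n ⊕ Fin n → A) (P : Fin n ⊕ Fin n → ZMod 2)
    (x1 : ∀ k, X (Sum.inl k) = x k)
    (x2 : ∀ k, X (Sum.inr k) = -(gsign K (pe k * pe k)) • y k)
    (y1 : ∀ k, Y (Sum.inl k) = y k)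
    (y2 : ∀ k, Y (Sum.inr k) = x k)
    (p1 : ∀ k, P (Sum.inl k) = pe k)
    (p2 : ∀ k, P (Sum.inr k) = pe k) : SkewSol (K := K) X Y P P := by
  unfold SkewSol
  simp only [Fintype.sum_sum_type, x1, x2, y1, y2, p1, p2, ← TensorProduct.smul_tmul',
    TensorProduct.tmul_smul, smul_smul, mul_neg, gs_sq]
  simp [neg_smul, Finset.sum_neg_distrib, add_comm]

lemma contract {n : ℕ} {A : Type*} [AddCommGroup A] [Module K A]
    (pe : Fin n → ZMod 2) (β : V ≃ₗ[K] V) (b : Module.Basis (Fin n) K V)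
    (I : J →ₗ[K] A) (N : Module.Dual K V →ₗ[K] A) (f : A →ₗ[K] J) (s : A →ₗ[K] Module.Dual K V)
    (fI : ∀ x, f (I x) = x) (fN : ∀ x, f (N x) = 0) (sN : ∀ x, s (N x) = x)
    (η : Fin n → Module.Dual K V) (hη : ∀ k, η k = b.coord k ∘ₗ β.symm.toLinearMap)
    (d : Fin n → Fin n → J)
    (h : ∑ k, ∑ l, (gsign K (pe k * pe l) • ((I (d k l) ⊗ₜ[K] N (η k)) ⊗ₜ[K] N (η l))
      + gsign K (pe k) • ((N (η k) ⊗ₜ[K] I (d k l)) ⊗ₜ[K] N (η l))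
      + gsign K (pe k + pe l + pe k * pe l) •
        ((N (η k) ⊗ₜ[K] N (η l)) ⊗ₜ[K] I (d k l))) = 0) (i j : Fin n) : d i j = 0 := by
  let e : Fin n → (A →ₗ[K] K) := fun k => LinearMap.applyₗ (β (b k)) ∘ₗ s
  have he : ∀ k l, e k (N (η l)) = if l = k then 1 else 0 := by
    intro k l
    simp [e, sN, hη, Finsupp.single_apply, eq_comm]
  have h2 := congrArg ((TensorProduct.rid K J).toLinearMap ∘ₗ
    TensorProduct.map ((TensorProduct.rid K J).toLinearMap ∘ₗ TensorProduct.map f (e i)) (e j)) h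
  simp [fI, fN, he] at h2
  have h3 := gs_sq (K := K) (pe i * pe j)
  rcases h2 with h2 | h2
  · simp [h2] at h3
  · exact h2

lemma contract' {n : ℕ} {A : Type*} [AddCommGroup A] [Module K A]
    (pe : Fin n → ZMod 2)
    (I : J →ₗ[K] A) (N : Module.Dual K V →ₗ[K] A)
    (η : Fin n → Module.Dual K V)
    (d : Fin n → Fin n → J) (h : ∀ k l, d k l = 0) :
    ∑ k, ∑ l, (gsign K (pe k * pe l) • ((I (d k l) ⊗ₜ[K] N (η k)) ⊗ₜ[K] N (η l))
      + gsign K (pe k) • ((N (η k) ⊗ₜ[K] I (d k l)) ⊗ₜ[K] N (η l))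
      + gsign K (pe k + pe l + pe k * pe l) •
        ((N (η k) ⊗ₜ[K] N (η l)) ⊗ₜ[K] I (d k l))) = 0 := by
  simp [h]

end OOp
/-- for an even linear `T : V → J` with `T∘β = α∘T`, the following are
equivalent: (i) `T` is an O-operator associated to `(V, π, β)`; (ii) `r = T − σ(T)`
is a super skew-symmetric solution of the super Hom-Jordan Yang-Baxter equation in
`J ⋉_{π⋆} V*`; (iii) `T − σ(T)` (i.e. its associated map `T_r`) is an O-operator of
`J ⋉_{π⋆} V*` associated to its coadjoint representation `ad⋆`. -/
theorem oOperator_tfae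
    [FiniteDimensional K J] [FiniteDimensional K V]
    (g : ZMod 2 → Submodule K J) (hg : DirectSum.IsInternal g)
    (m : J →ₗ[K] J →ₗ[K] J) (α : J ≃ₗ[K] J)
    (hJ : IsMultHomJordan g m α.toLinearMap)
    (gV : ZMod 2 → Submodule K V) (hgV : DirectSum.IsInternal gV)
    (π : J →ₗ[K] Module.End K V) (β : V ≃ₗ[K] V)
    (hrep : IsRep g m α.toLinearMap gV π β.toLinearMap)
    (πs : J →ₗ[K] Module.End K (Module.Dual K V))
    (hπs : ∀ i j : ZMod 2, ∀ x ∈ g i, ∀ ξ ∈ dualGrading gV j, ∀ u : V,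
      πs x ξ u = gsign K (i * j) * ξ (π (α.symm x) (β.symm (β.symm u))))
    (m' : (J × Module.Dual K V) →ₗ[K] (J × Module.Dual K V) →ₗ[K] (J × Module.Dual K V))
    (hm' : IsSemidirectMul g (dualGrading gV) m πs m')
    (T : V →ₗ[K] J) (hTe : ∀ i : ZMod 2, ∀ v ∈ gV i, T v ∈ g i)
    (hTβ : ∀ v : V, T (β v) = α (T v))
    (n : ℕ) (b : Module.Basis (Fin n) K V) (pe : Fin n → ZMod 2)
    (hb : ∀ k, b k ∈ gV (pe k))
    (γe : (J × Module.Dual K V) ≃ₗ[K] (J × Module.Dual K V))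
    (hγe : γe.toLinearMap = α.toLinearMap.prodMap β.symm.toLinearMap.dualMap)
    (Tr : Module.Dual K (J × Module.Dual K V) →ₗ[K] (J × Module.Dual K V))
    (hTr : ∀ a c : ZMod 2, ∀ us ∈ dualGrading (prodGrading g (dualGrading gV)) a,
      ∀ vs ∈ dualGrading (prodGrading g (dualGrading gV)) c,
      us (Tr vs) = ∑ l, gsign K (c * rP pe l) * us (rX T b pe l) * vs (rY T b l))
    (adStarA : (J × Module.Dual K V) →ₗ[K]
      Module.End K (Module.Dual K (J × Module.Dual K V)))
    (hadA : ∀ i j : ZMod 2, ∀ w ∈ prodGrading g (dualGrading gV) i,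
      ∀ f ∈ dualGrading (prodGrading g (dualGrading gV)) j,
      ∀ w' : J × Module.Dual K V,
      adStarA w f w' = gsign K (i * j) * f (γe.symm (γe.symm (m' (γe w) w')))) :
    (IsOOperator g m α.toLinearMap gV π β.toLinearMap T ↔
      (SkewSol (K := K) (rX T b pe) (rY T b) (rP pe) (rP pe) ∧
        YBESol (K := K) m' (α.toLinearMap.prodMap β.symm.toLinearMap.dualMap)
          (rX T b pe) (rY T b) (rP pe) (rP pe))) ∧
    (IsOOperator g m α.toLinearMap gV π β.toLinearMap T ↔
      IsOOperator (prodGrading g (dualGrading gV)) m' γe.toLinearMap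
        (dualGrading (prodGrading g (dualGrading gV))) adStarA
        (γe.symm.toLinearMap.dualMap) Tr) := by
  obtain ⟨⟨hme, hαe, hsc, -⟩, hmul⟩ := hJ
  obtain ⟨hπe, hβe, hπβ0, -, -⟩ := hrep
  have hπβ : ∀ x v, β (π x v) = π (α x) (β v) := fun x v => LinearMap.congr_fun (hπβ0 x) v
  have hαs := OOp.symm_even g hg α hαe
  have hβs := OOp.symm_even gV hgV β hβe
  have hc := OOp.coord_mem gV hgV b pe hb
  have hTb : ∀ k, T (b k) ∈ g (pe k) := fun k => hTe _ _ (hb k)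
  have hiff := OOp.oop_iff g α m gV hgV π β T hTe hTβ b pe hb
  constructor
  · rw [hiff]
    have hid := OOp.ybe_id g α m gV hgV π β hαs hβs hπe hπβ πs hπs m' T hTe hTβ b pe hb
      (α.toLinearMap.prodMap β.symm.toLinearMap.dualMap)
      (LinearMap.inl K J (Module.Dual K V)) (LinearMap.inr K J (Module.Dual K V))
      (fun k => b.coord k ∘ₗ β.symm.toLinearMap) (fun _ => rfl)
      (by
        intro k l
        have := hm' (pe k) (pe l) _ (hTb k) 0 (zero_mem _) _ (hTb l) 0 (zero_mem _)
        simpa using this)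
      (by
        intro k l
        have := hm' (pe k) (pe l) _ (hTb k) 0 (zero_mem _) 0 (zero_mem _) _ (hc l)
        simpa using this)
      (by
        intro k l
        have := hm' (pe k) (pe l) 0 (zero_mem _) _ (hc k) _ (hTb l) 0 (zero_mem _)
        simpa using this)
      (by
        intro k l
        have := hm' (pe k) (pe l) 0 (zero_mem _) _ (hc k) 0 (zero_mem _) _ (hc l)
        refine this.trans ?_
        ext <;> simp)
      (by intro x; simp)
      (by
        intro k
        simp only [LinearMap.inr_apply, LinearMap.prodMap_apply, map_zero]; rfl)
      (rX T b pe) (rY T b) (rP pe) (fun _ => rfl) (fun _ => rfl) (fun _ => rfl) (fun _ => rfl)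
      (fun _ => rfl) (fun _ => rfl)
    constructor
    · intro h
      refine ⟨OOp.skew pe (fun k => (T (b k), 0)) (fun k => (0, b.coord k)) _ _ _
        (fun _ => rfl) (fun _ => rfl) (fun _ => rfl) (fun _ => rfl)
        (fun _ => rfl) (fun _ => rfl), ?_⟩
      exact hid.trans (OOp.contract' pe _ _ _ _ h)
    · rintro ⟨-, h⟩
      exact OOp.contract pe β b (LinearMap.inl K J (Module.Dual K V))
        (LinearMap.inr K J (Module.Dual K V)) (LinearMap.fst K _ _) (LinearMap.snd K _ _)
        (fun _ => rfl) (fun _ => rfl) (fun _ => rfl) _ (fun _ => rfl) _ (hid.symm.trans h)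
  · have add2 : ∀ i j : ZMod 2, i + (i + j + 1) = j + 1 := by decide
    have hγ : ∀ x ξ, γe (x, ξ) = (α x, ξ ∘ₗ β.symm.toLinearMap) := fun x ξ =>
      LinearMap.congr_fun hγe (x, ξ)
    have hγs : ∀ x ξ, γe.symm (x, ξ) = (α.symm x, ξ ∘ₗ β.toLinearMap) := by
      intro x ξ
      rw [LinearEquiv.symm_apply_eq, hγ]
      ext <;> simp
    have hγE : ∀ i, ∀ w ∈ prodGrading g (dualGrading gV) i,
        γe w ∈ prodGrading g (dualGrading gV) i := by
      rintro i ⟨x, ξ⟩ ⟨hx, hξ⟩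
      rw [hγ]
      exact ⟨hαe _ _ hx, fun y hy => hξ _ (hβs _ _ hy)⟩
    have hγsE : ∀ i, ∀ w ∈ prodGrading g (dualGrading gV) i,
        γe.symm w ∈ prodGrading g (dualGrading gV) i := by
      rintro i ⟨x, ξ⟩ ⟨hx, hξ⟩
      rw [hγs]
      exact ⟨hαs _ _ hx, fun y hy => hξ _ (hβe _ _ hy)⟩
    have hπsE : ∀ i j, ∀ x ∈ g i, ∀ ξ ∈ dualGrading gV j,
        πs x ξ ∈ dualGrading gV (i + j) := by
      intro i j x hx ξ hξ u hu
      rw [hπs i j x hx ξ hξ]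
      have := hπe _ _ _ (hαs _ _ hx) _ (hβs _ _ (hβs _ _ hu))
      rw [add2] at this
      rw [hξ _ this, mul_zero]
    have hmE : ∀ i j, ∀ w ∈ prodGrading g (dualGrading gV) i,
        ∀ w' ∈ prodGrading g (dualGrading gV) j,
        m' w w' ∈ prodGrading g (dualGrading gV) (i + j) := by
      rintro i j ⟨x, ξ⟩ ⟨hx, hξ⟩ ⟨y, ζ⟩ ⟨hy, hζ⟩
      rw [hm' i j x hx ξ hξ y hy ζ hζ]
      refine ⟨hme _ _ _ hx _ hy, Submodule.add_mem _ (hπsE _ _ _ hx _ hζ)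
        (Submodule.smul_mem _ _ ?_)⟩
      rw [add_comm]
      exact hπsE _ _ _ hy _ hξ
    have hadE : ∀ i j, ∀ w ∈ prodGrading g (dualGrading gV) i,
        ∀ f ∈ dualGrading (prodGrading g (dualGrading gV)) j,
        adStarA w f ∈ dualGrading (prodGrading g (dualGrading gV)) (i + j) := by
      intro i j w hw f hf w' hw'
      rw [hadA i j w hw f hf]
      have := hmE _ _ _ (hγE _ _ hw) _ hw'
      rw [add2] at this
      rw [hf _ (hγsE _ _ (hγsE _ _ this)), mul_zero]
    have hinr : ∀ k, ((0 : J), b.coord k) ∈ prodGrading g (dualGrading gV) (pe k) :=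
      fun k => ⟨zero_mem _, hc k⟩
    have hinl : ∀ i, ∀ x ∈ g i, (x, (0 : Module.Dual K V)) ∈ prodGrading g (dualGrading gV) i :=
      fun i x hx => ⟨hx, zero_mem _⟩
    obtain ⟨U, hU⟩ : ∃ U : Module.Dual K (J × Module.Dual K V) → V,
        ∀ f, U f = ∑ k, f (0, b.coord k) • b k := ⟨_, fun _ => rfl⟩
    have hU3 : ∀ f w, (∀ k, f (0, b.coord k) = b.coord k w) → U f = w := by
      intro f w h
      rw [hU]
      simp_rw [h]
      exact b.sum_repr w
    have hU1 : ∀ (f : Module.Dual K (J × Module.Dual K V)) (ξ : Module.Dual K V), f (0, ξ) = ξ (U f) := by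
      intro f ξ
      have e : ξ = ∑ k, ξ (b k) • b.coord k := by
        refine b.ext fun j => ?_
        simp [Finsupp.single_apply]
      have e2 : ((0 : J), ξ) = ∑ k, ξ (b k) • ((0 : J), b.coord k) := by
        have := congrArg (LinearMap.inr K J (Module.Dual K V)) e
        rw [map_sum] at this
        simp only [map_smul] at this
        exact this
      rw [e2, map_sum, hU, map_sum]
      simp only [map_smul, smul_eq_mul, mul_comm]
    have hU2 : ∀ i, ∀ f ∈ dualGrading (prodGrading g (dualGrading gV)) i, U f ∈ gV i := by
      intro i f hf
      rw [hU]
      refine Submodule.sum_mem _ fun k _ => ?_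
      by_cases h : i = pe k
      · rw [h]; exact Submodule.smul_mem _ _ (hb k)
      · rw [hf _ (by rw [← OOp.ne_add _ _ h]; exact hinr k), zero_smul]
        exact zero_mem _
    have hsp : ∀ (f : Module.Dual K (J × Module.Dual K V)) x ξ,
        f (x, ξ) = f (x, 0) + ξ (U f) := by
      intro f x ξ
      rw [← hU1, ← map_add]; simp
    have hev : ∀ i, ∀ v ∈ gV i,
        ((LinearMap.applyₗ v : Module.Dual K V →ₗ[K] K) ∘ₗ LinearMap.snd K J (Module.Dual K V)) ∈
        dualGrading (prodGrading g (dualGrading gV)) i := by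
      rintro i v hv ⟨x, ξ⟩ ⟨hx, hξ⟩
      exact hξ v (by rwa [add_assoc, OOp.z11, add_zero])
    have hTrF : ∀ i, ∀ f ∈ dualGrading (prodGrading g (dualGrading gV)) i,
        Tr f = (gsign K i • T (U f), -(f ∘ₗ LinearMap.inl K J _ ∘ₗ T)) := by
      intro i f hf
      refine Prod.ext ?_ ?_
      · refine OOp.functional_sep g hg _ _ fun a φ hφ => ?_
        have h := hTr a i (φ ∘ₗ LinearMap.fst K J _) (by
          rintro ⟨x, ξ⟩ ⟨hx, hξ⟩
          exact hφ x hx) f hf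
        simp only [Fintype.sum_sum_type, rX, rY, rP, Sum.elim_inl, Sum.elim_inr,
          LinearMap.comp_apply, LinearMap.fst_apply, Prod.smul_fst, smul_zero, map_zero, mul_zero,
          zero_mul, Finset.sum_const_zero, add_zero] at h
        rw [h, hU, map_smul, map_sum, map_sum, smul_eq_mul, Finset.mul_sum]
        refine Finset.sum_congr rfl fun k _ => ?_
        have e := OOp.dual_sign _ i (pe k) f hf _ (hinr k) (fun q => gsign K (i * q))
        have e2 : gsign K (i * i) = gsign K i := by
          rcases OOp.z2 i with rfl | rfl <;> simp
        rw [e2] at e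
        simp only [map_smul, smul_eq_mul]
        linear_combination -φ (T (b k)) * e
      · refine b.ext fun j => ?_
        have h := hTr (pe j) i _ (hev (pe j) (b j) (hb j)) f hf
        simp only [Fintype.sum_sum_type, rX, rY, rP, Sum.elim_inl, Sum.elim_inr,
          LinearMap.comp_apply, LinearMap.snd_apply, Prod.smul_snd, smul_zero, map_zero, mul_zero,
          zero_mul, Finset.sum_const_zero, zero_add, LinearMap.applyₗ_apply_apply,
          LinearMap.zero_apply] at h
        rw [h, Finset.sum_eq_single j]
        · have e := OOp.dual_sign _ i (pe j) f hf _ (hinl _ _ (hTb j))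
            (fun q => gsign K (i * pe j) * gsign K (q * pe j))
          have e2 := OOp.gs_sq (K := K) (i * pe j)
          rw [e2] at e
          simp
          linear_combination -e
        · intro k _ hk
          simp [Finsupp.single_apply, Ne.symm hk]
        · simp
    have hTrE : ∀ i, ∀ f ∈ dualGrading (prodGrading g (dualGrading gV)) i,
        Tr f ∈ prodGrading g (dualGrading gV) i := by
      intro i f hf
      rw [hTrF i f hf]
      refine ⟨Submodule.smul_mem _ _ (hTe _ _ (hU2 i f hf)), Submodule.neg_mem _ ?_⟩
      intro y hy
      exact hf _ (hinl _ _ (hTe _ _ hy))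
    have hγTr : ∀ i, ∀ f ∈ dualGrading (prodGrading g (dualGrading gV)) i,
        γe (Tr f) = (gsign K i • α (T (U f)),
          -(f ∘ₗ LinearMap.inl K J _ ∘ₗ T ∘ₗ β.symm.toLinearMap)) := by
      intro i f hf
      rw [hTrF i f hf, hγ, map_smul]; rfl
    have hdual : ∀ i, ∀ f ∈ dualGrading (prodGrading g (dualGrading gV)) i,
        γe.symm.toLinearMap.dualMap f ∈ dualGrading (prodGrading g (dualGrading gV)) i :=
      fun i f hf w hw => hf _ (hγsE _ _ hw)
    have hTs : ∀ v, T (β.symm v) = α.symm (T v) := by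
      intro v
      rw [LinearEquiv.eq_symm_apply, ← hTβ, β.apply_symm_apply]
    have hcom : ∀ i, ∀ f ∈ dualGrading (prodGrading g (dualGrading gV)) i,
        γe (Tr f) = Tr (γe.symm.toLinearMap.dualMap f) := by
      intro i f hf
      have e : U (γe.symm.toLinearMap.dualMap f) = β (U f) := by
        refine hU3 _ _ fun k => ?_
        rw [LinearMap.dualMap_apply, LinearEquiv.coe_coe, hγs, hsp]
        simp only [map_zero, Prod.mk_zero_zero, zero_add]
        rfl
      rw [hγTr i f hf, hTrF i _ (hdual i f hf), e, hTβ]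
      refine Prod.ext rfl ?_
      refine LinearMap.ext fun v => ?_
      simp [hγs, hTs]
    have hdec : ∀ f : Module.Dual K (J × Module.Dual K V),
        ∃ f0 ∈ dualGrading (prodGrading g (dualGrading gV)) 0,
        ∃ f1 ∈ dualGrading (prodGrading g (dualGrading gV)) 1, f = f0 + f1 := by
      intro f
      obtain ⟨P, hP1, hP2, hP3, hP4⟩ := OOp.exists_proj g hg
      obtain ⟨Q, hQ1, hQ2, hQ3, hQ4⟩ := OOp.exists_proj gV hgV
      have hm : ∀ i, (f ∘ₗ LinearMap.inl K J _ ∘ₗ P i ∘ₗ LinearMap.fst K J (Module.Dual K V) +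
          (LinearMap.applyₗ (Q i (U f)) : Module.Dual K V →ₗ[K] K) ∘ₗ
            LinearMap.snd K J (Module.Dual K V)) ∈
          dualGrading (prodGrading g (dualGrading gV)) i := by
        intro i
        refine Submodule.add_mem _ ?_ (hev i _ (hQ1 i _))
        rintro ⟨x, ξ⟩ ⟨hx, hξ⟩
        simp only [LinearMap.comp_apply, LinearMap.fst_apply]
        rw [hP3 i x hx]; exact map_zero f
      refine ⟨_, hm 0, _, hm 1, ?_⟩
      refine LinearMap.ext fun w => ?_
      obtain ⟨x, ξ⟩ := w
      have e1 : f (x, 0) = f (P 0 x, 0) + f (P 1 x, 0) := by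
        rw [← map_add, Prod.mk_add_mk, hP4, add_zero]
      have e2 : ξ (U f) = ξ (Q 0 (U f)) + ξ (Q 1 (U f)) := by
        rw [← map_add, hQ4]
      rw [hsp, e1, e2]
      simp only [LinearMap.add_apply, LinearMap.comp_apply, LinearMap.fst_apply,
        LinearMap.snd_apply, LinearMap.inl_apply, LinearMap.applyₗ_apply_apply]
      ring
    have hcomA : ∀ f, γe (Tr f) = Tr (γe.symm.toLinearMap.dualMap f) := by
      intro f
      obtain ⟨f0, h0, f1, h1, rfl⟩ := hdec f
      rw [map_add, map_add, map_add, map_add, hcom 0 f0 h0, hcom 1 f1 h1]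
    have hneg : ∀ i, ∀ f ∈ dualGrading (prodGrading g (dualGrading gV)) i,
        -(f ∘ₗ LinearMap.inl K J _ ∘ₗ T) ∈ dualGrading gV i := by
      intro i f hf
      have := hTrE i f hf
      rw [hTrF i f hf] at this
      exact this.2
    have hnegβ : ∀ i, ∀ f ∈ dualGrading (prodGrading g (dualGrading gV)) i,
        -(f ∘ₗ LinearMap.inl K J _ ∘ₗ T ∘ₗ β.symm.toLinearMap) ∈ dualGrading gV i := by
      intro i f hf u hu
      exact hneg i f hf _ (hβs _ _ hu)
    have hadU : ∀ i j, ∀ f ∈ dualGrading (prodGrading g (dualGrading gV)) i,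
        ∀ h ∈ dualGrading (prodGrading g (dualGrading gV)) j,
        U (adStarA (Tr f) h) = π (T (U f)) (U h) := by
      intro i j f hf h hh
      refine hU3 _ _ fun k => ?_
      rw [hadA i j _ (hTrE i f hf) h hh, hγTr i f hf]
      have hu := hTe _ _ (hU2 i f hf)
      have hu' : gsign K i • α (T (U f)) ∈ g i := Submodule.smul_mem _ _ (hαe _ _ hu)
      rw [hm' i (pe k) _ hu' _ (hnegβ i f hf) 0 (zero_mem _) _ (hc k), hγs, hγs, hsp]
      simp only [map_zero, LinearMap.zero_apply, smul_zero, add_zero]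
      rw [← Prod.zero_eq_mk, map_zero, zero_add]
      simp only [LinearMap.comp_apply, LinearEquiv.coe_coe, map_smul, LinearMap.smul_apply]
      rw [hπs i (pe k) (α (T (U f))) (hαe _ _ hu) _ (hc k)]
      simp only [LinearEquiv.coe_coe, LinearEquiv.symm_apply_apply, smul_eq_mul]
      have e := OOp.coord_sign gV hgV b pe hb k (i + j) _ (hπe _ _ _ hu _ (hU2 j h hh))
        (fun q => gsign K (i * q))
      rw [e]
      have e2 : gsign K (i * j) * (gsign K i * gsign K (i * (i + j))) = 1 := by
        rcases OOp.z2 i with rfl | rfl <;> rcases OOp.z2 j with rfl | rfl <;>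
          simp [OOp.gs0, OOp.gs1, OOp.z11]
      linear_combination (b.coord k (π (T (U f)) (U h))) * e2
    have hadJ : ∀ i j p, ∀ f ∈ dualGrading (prodGrading g (dualGrading gV)) i,
        ∀ h ∈ dualGrading (prodGrading g (dualGrading gV)) j, ∀ w ∈ gV p,
        adStarA (Tr f) h (T w, 0) = gsign K (i * j) *
          (gsign K i * h (m (T (β.symm (U f))) (T (β.symm (β.symm w))), 0)
            - f (T (π (T (β.symm (β.symm w))) (β.symm (U h))), 0)) := by
      intro i j p f hf h hh w hw
      rw [hadA i j _ (hTrE i f hf) h hh, hγTr i f hf]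
      have hu := hTe _ _ (hU2 i f hf)
      have hu' : gsign K i • α (T (U f)) ∈ g i := Submodule.smul_mem _ _ (hαe _ _ hu)
      have hTw := hTe _ _ hw
      rw [hm' i p _ hu' _ (hnegβ i f hf) _ hTw 0 (zero_mem _), hγs, hγs, hsp]
      have hms : ∀ x y, α.symm (m x y) = m (α.symm x) (α.symm y) := by
        intro x y
        rw [LinearEquiv.symm_apply_eq]
        have := hmul (α.symm x) (α.symm y)
        simpa using this.symm
      have hπβs : ∀ x v, β.symm (π x v) = π (α.symm x) (β.symm v) := by
        intro x v
        rw [LinearEquiv.symm_apply_eq, hπβ]; simp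
      simp only [map_smul, map_zero, zero_add, LinearMap.comp_apply, LinearMap.smul_apply,
        LinearEquiv.coe_coe]
      rw [hπs p i _ hTw _ (hnegβ i f hf)]
      simp only [hms, LinearEquiv.symm_apply_apply, LinearMap.neg_apply, LinearMap.comp_apply,
        LinearEquiv.coe_coe, LinearMap.inl_apply, hπβs, ← hTs]
      have e3 : ∀ (c : K) (x : J), h (c • x, 0) = c * h (x, 0) := by
        intro c x
        rw [← smul_eq_mul, ← map_smul, Prod.smul_mk, smul_zero]
      rw [e3, smul_eq_mul]
      have e2 : gsign K (i * p) * gsign K (p * i) = 1 := by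
        rw [mul_comm p i]; exact OOp.gs_sq _
      linear_combination (-gsign K (i * j) *
        f (T (π (T (β.symm (β.symm w))) (β.symm (U h))), 0)) * e2
    constructor
    · rintro ⟨-, -, hO⟩
      refine ⟨hTrE, hcomA, ?_⟩
      intro i j f hf h hh
      have hG1 := hadE i j _ (hTrE i f hf) h hh
      have hG2 := hadE j i _ (hTrE j h hh) f hf
      have hG : adStarA (Tr f) h + gsign K (i * j) • adStarA (Tr h) f ∈
          dualGrading (prodGrading g (dualGrading gV)) (i + j) := by
        refine Submodule.add_mem _ hG1 (Submodule.smul_mem _ _ ?_)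
        rw [add_comm]; exact hG2
      have hUG : U (adStarA (Tr f) h + gsign K (i * j) • adStarA (Tr h) f) =
          π (T (U f)) (U h) + gsign K (i * j) • π (T (U h)) (U f) := by
        refine hU3 _ _ fun k => ?_
        rw [LinearMap.add_apply, LinearMap.smul_apply, hU1, hU1, hadU i j f hf h hh,
          hadU j i h hh f hf, map_add, map_smul]
      rw [hTrF _ _ hG, hUG, ← hO i j _ (hU2 i f hf) _ (hU2 j h hh)]
      have hu := hTe _ _ (hU2 i f hf)
      have hv := hTe _ _ (hU2 j h hh)
      have hE := hm' i j (gsign K i • T (U f)) (Submodule.smul_mem _ _ hu) _ (hneg i f hf)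
        (gsign K j • T (U h)) (Submodule.smul_mem _ _ hv) _ (hneg j h hh)
      rw [← hTrF i f hf, ← hTrF j h hh] at hE
      rw [hE]
      refine Prod.ext ?_ ?_
      · simp only [map_smul, LinearMap.smul_apply, smul_smul]
        congr 1
        rcases OOp.z2 i with rfl | rfl <;> rcases OOp.z2 j with rfl | rfl <;>
          simp [OOp.gs0, OOp.gs1, OOp.z11]
      · refine b.ext fun k => ?_
        simp only [LinearMap.neg_apply, LinearMap.comp_apply, LinearMap.inl_apply,
          LinearMap.add_apply, LinearMap.smul_apply, map_smul]
        rw [hadJ i j (pe k) f hf h hh _ (hb k), hadJ j i (pe k) h hh f hf _ (hb k),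
          hπs i j _ hu _ (hneg j h hh), hπs j i _ hv _ (hneg i f hf)]
        have hw' := hβs _ _ (hβs _ _ (hb k))
        have hu' := hβs _ _ (hU2 i f hf)
        have hv' := hβs _ _ (hU2 j h hh)
        rw [hO i (pe k) _ hu' _ hw', hO j (pe k) _ hv' _ hw', ← hTs, ← hTs]
        simp only [LinearMap.neg_apply, LinearMap.comp_apply, LinearMap.inl_apply, smul_eq_mul]
        have e3 : ∀ (f : Module.Dual K (J × Module.Dual K V)) (c : K) (x y : V),
            f (T (x + c • y), 0) = f (T x, 0) + c * f (T y, 0) := by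
          intro f c x y
          rw [← smul_eq_mul, ← map_smul, ← map_add]; simp
        rw [e3, e3]
        have d1 := OOp.dual_sign _ j _ h hh _ (hinl _ _ (hTe _ _ (hπe _ _ _ (hTe _ _ hw') _ hu')))
          (fun q => gsign K (i * q) * gsign K i * gsign K (i * pe k))
        have d2 := OOp.dual_sign _ i _ f hf _ (hinl _ _ (hTe _ _ (hπe _ _ _ (hTe _ _ hw') _ hv')))
          (fun q => gsign K (q * j) * gsign K j * gsign K (j * pe k))
        have s1 : ∀ p q : ZMod 2, gsign K (p * (q + p)) * gsign K p * gsign K (p * q) = 1 := by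
          intro p q
          rcases OOp.z2 p with rfl | rfl <;> rcases OOp.z2 q with rfl | rfl <;>
          simp [OOp.gs0, OOp.gs1, OOp.z11]
        rw [s1] at d1
        rw [mul_comm (pe k + j) j, s1] at d2
        have s2 := OOp.gs_sq (K := K) (i * j)
        rw [mul_comm j i]
        generalize h (T (π (T (β.symm (β.symm (b k)))) (β.symm (U f))), 0) = a1 at *
        generalize f (T (π (T (β.symm (β.symm (b k)))) (β.symm (U h))), 0) = a2 at *
        generalize h (T (π (T (β.symm (U f))) (β.symm (β.symm (b k)))), 0) = a3 at *
        generalize f (T (π (T (β.symm (U h))) (β.symm (β.symm (b k)))), 0) = a4 at *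
        generalize gsign K (i * j) = sij at *
        linear_combination d1 + sij * d2 - a1 * s2
    · rintro ⟨-, -, hO⟩
      refine ⟨hTe, fun v => (hTβ v).symm, ?_⟩
      intro i j u hu v hv
      have hf := hev i u hu
      have hh := hev j v hv
      generalize hfe : ((LinearMap.applyₗ u : Module.Dual K V →ₗ[K] K) ∘ₗ
        LinearMap.snd K J (Module.Dual K V)) = f at hf
      generalize hhe : ((LinearMap.applyₗ v : Module.Dual K V →ₗ[K] K) ∘ₗ
        LinearMap.snd K J (Module.Dual K V)) = h at hh
      have hUf : U f = u := hU3 _ _ fun k => by rw [← hfe]; rfl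
      have hUh : U h = v := hU3 _ _ fun k => by rw [← hhe]; rfl
      have hG1 := hadE i j _ (hTrE i f hf) h hh
      have hG2 := hadE j i _ (hTrE j h hh) f hf
      have hG : adStarA (Tr f) h + gsign K (i * j) • adStarA (Tr h) f ∈
          dualGrading (prodGrading g (dualGrading gV)) (i + j) := by
        refine Submodule.add_mem _ hG1 (Submodule.smul_mem _ _ ?_)
        rw [add_comm]; exact hG2
      have hUG : U (adStarA (Tr f) h + gsign K (i * j) • adStarA (Tr h) f) =
          π (T (U f)) (U h) + gsign K (i * j) • π (T (U h)) (U f) := by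
        refine hU3 _ _ fun k => ?_
        rw [LinearMap.add_apply, LinearMap.smul_apply, hU1, hU1, hadU i j f hf h hh,
          hadU j i h hh f hf, map_add, map_smul]
      have key := hO i j f hf h hh
      have hTu := hTe _ _ hu
      have hTv := hTe _ _ hv
      rw [hTrF _ _ hG, hUG, hTrF i f hf, hTrF j h hh, hUf, hUh,
        hm' i j _ (Submodule.smul_mem _ _ hTu) _ (hneg i f hf) _ (Submodule.smul_mem _ _ hTv) _
        (hneg j h hh)] at key
      have key1 := congrArg Prod.fst key
      simp only [map_smul, LinearMap.smul_apply, smul_smul] at key1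
      have s1 : gsign K j * gsign K i = gsign K (i + j) := by
        rcases OOp.z2 i with rfl | rfl <;> rcases OOp.z2 j with rfl | rfl <;>
          simp [OOp.gs0, OOp.gs1, OOp.z11]
      have s2 := OOp.gs_sq (K := K) (i + j)
      have s3 : ∀ x : K, gsign K (i + j) * (gsign K (i + j) * x) = x := by
        intro x
        rw [← mul_assoc, s2, one_mul]
      have key2 := congrArg (fun x => gsign K (i + j) • x) key1
      simpa [s1, mul_comm (gsign K i), smul_smul, s2, s3] using key2
end
end

section
/- Let (J, ·, α) be a finite-dimensional multiplicative Hom-Jordan superalgebra with α invertible, and let r ∈ J ⊗ J be even, super skew-symmetric and nondegenerate (so T_r : J* → J is invertible). Then r is a solution of the super Hom-Jordan Yang-Baxter equation satisfying (α ⊗ α)(r) = r if and only if the nondegenerate super skew-symmetric bilinear form B on J defined by B(x, y) = ⟨T_r⁻¹(x), y⟩ is symplectic, i.e. satisfies B(α(x), α(y)) = B(x, y) and B(x·y, α(z)) = B(α(x), y·z) + (-1)^{|x|(|y|+|z|)} B(α(y), z·x) for all homogeneous x, y, z ∈ J. -/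
open scoped TensorProduct

noncomputable section

variable {K : Type*} [Field K] [CharZero K]
variable {J V : Type*} [AddCommGroup J] [Module K J] [AddCommGroup V] [Module K V]

theorem gs_sq (e : ZMod 2) : gsign K e * gsign K e = 1 := by
  unfold gsign; rw [← mul_pow]; simp

theorem zm_cases (e : ZMod 2) : e = 0 ∨ e = 1 := by
  revert e; decide

theorem gs_mul_self (e : ZMod 2) : gsign K (e * e) = gsign K e := by
  fin_cases e <;> rfl

def ev2 (ξ η : Module.Dual K J) : J ⊗[K] J →ₗ[K] K :=
  LinearMap.mul' K K ∘ₗ TensorProduct.map ξ η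

def ev3 (ξ η ζ : Module.Dual K J) : (J ⊗[K] J) ⊗[K] J →ₗ[K] K :=
  LinearMap.mul' K K ∘ₗ TensorProduct.map (ev2 ξ η) ζ

theorem ev2_tmul (ξ η : Module.Dual K J) (a b : J) :
    ev2 ξ η (a ⊗ₜ[K] b) = ξ a * η b := by simp [ev2]

theorem ev3_tmul (ξ η ζ : Module.Dual K J) (a b c : J) :
    ev3 ξ η ζ ((a ⊗ₜ[K] b) ⊗ₜ[K] c) = ξ a * η b * ζ c := by simp [ev3, ev2_tmul]

theorem ev2_sep [FiniteDimensional K J] (t : J ⊗[K] J) (h : ∀ ξ η, ev2 ξ η t = 0) : t = 0 := by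
  let b := Module.finBasis K J
  apply (b.tensorProduct b).ext_elem
  rintro ⟨i, j⟩
  have : (b.tensorProduct b).coord (i, j) = ev2 (b.coord i) (b.coord j) := by
    ext u v; simp [ev2_tmul, mul_comm]
  have h2 := h (b.coord i) (b.coord j)
  rw [← this] at h2
  simpa using h2

theorem ev3_sep [FiniteDimensional K J] (t : (J ⊗[K] J) ⊗[K] J)
    (h : ∀ ξ η ζ, ev3 ξ η ζ t = 0) : t = 0 := by
  let b := Module.finBasis K J
  apply ((b.tensorProduct b).tensorProduct b).ext_elem
  rintro ⟨⟨i, j⟩, k⟩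
  have : ((b.tensorProduct b).tensorProduct b).coord ((i, j), k)
      = ev3 (b.coord i) (b.coord j) (b.coord k) := by
    ext u v w; simp [ev3_tmul]; ring
  have h2 := h (b.coord i) (b.coord j) (b.coord k)
  rw [← this] at h2
  simpa using h2

theorem ev3_add1 (ξ ξ' η ζ : Module.Dual K J) (t) :
    ev3 (ξ + ξ') η ζ t = ev3 ξ η ζ t + ev3 ξ' η ζ t := by
  have : ev3 (ξ + ξ') η ζ = ev3 ξ η ζ + ev3 ξ' η ζ := by
    ext u v w; simp [ev3_tmul]; ring
  rw [this]; rfl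

theorem ev3_add2 (ξ η η' ζ : Module.Dual K J) (t) :
    ev3 ξ (η + η') ζ t = ev3 ξ η ζ t + ev3 ξ η' ζ t := by
  have : ev3 ξ (η + η') ζ = ev3 ξ η ζ + ev3 ξ η' ζ := by
    ext u v w; simp [ev3_tmul]; ring
  rw [this]; rfl

theorem ev3_add3 (ξ η ζ ζ' : Module.Dual K J) (t) :
    ev3 ξ η (ζ + ζ') t = ev3 ξ η ζ t + ev3 ξ η ζ' t := by
  have : ev3 ξ η (ζ + ζ') = ev3 ξ η ζ + ev3 ξ η ζ' := by
    ext u v w; simp [ev3_tmul]; ring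
  rw [this]; rfl

theorem dual_decomp (g : ZMod 2 → Submodule K J) (hg : DirectSum.IsInternal g)
    (ξ : Module.Dual K J) :
    ∃ ξ0 ∈ dualGrading g 0, ∃ ξ1 ∈ dualGrading g 1, ξ = ξ0 + ξ1 := by
  have hc : IsCompl (g 0) (g 1) :=
    (DirectSum.isInternal_submodule_iff_isCompl g (i := 0) (j := 1) (by decide)
      (Set.eq_of_subset_of_subset (fun e _ => zm_cases e) (Set.subset_univ _))).1 hg
  refine ⟨ξ ∘ₗ (g 0).projection (g 1) hc, ?_, ξ ∘ₗ (g 1).projection (g 0) hc.symm, ?_, ?_⟩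
  · intro z hz
    have hz : z ∈ g 1 := hz
    simp [(Submodule.projection_apply_eq_zero_iff hc).2 hz]
  · intro z hz
    have hz : z ∈ g 0 := hz
    simp [(Submodule.projection_apply_eq_zero_iff hc.symm).2 hz]
  · ext z
    simp only [LinearMap.add_apply, LinearMap.comp_apply, ← map_add]
    rw [Submodule.projection_add_projection_eq_self]

theorem ev3_sep_hom [FiniteDimensional K J] (g : ZMod 2 → Submodule K J)
    (hg : DirectSum.IsInternal g) (t : (J ⊗[K] J) ⊗[K] J)
    (h : ∀ a b c, ∀ ξ ∈ dualGrading g a, ∀ η ∈ dualGrading g b, ∀ ζ ∈ dualGrading g c,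
      ev3 ξ η ζ t = 0) : t = 0 := by
  apply ev3_sep
  intro ξ η ζ
  obtain ⟨ξ0, h0, ξ1, h1, rfl⟩ := dual_decomp g hg ξ
  obtain ⟨η0, h2, η1, h3, rfl⟩ := dual_decomp g hg η
  obtain ⟨ζ0, h4, ζ1, h5, rfl⟩ := dual_decomp g hg ζ
  simp only [ev3_add1, ev3_add2, ev3_add3]
  rw [h _ _ _ _ h0 _ h2 _ h4, h _ _ _ _ h0 _ h2 _ h5, h _ _ _ _ h0 _ h3 _ h4,
    h _ _ _ _ h0 _ h3 _ h5, h _ _ _ _ h1 _ h2 _ h4, h _ _ _ _ h1 _ h2 _ h5,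
    h _ _ _ _ h1 _ h3 _ h4, h _ _ _ _ h1 _ h3 _ h5]
  simp

theorem zm_ne {a b : ZMod 2} (h : a ≠ b) : a = b + 1 := by
  revert a b; decide

theorem dual_zero (g : ZMod 2 → Submodule K J) {a b : ZMod 2} {ξ : Module.Dual K J}
    (hξ : ξ ∈ dualGrading g a) {z : J} (hz : z ∈ g b) (h : b ≠ a) : ξ z = 0 := by
  rw [zm_ne h] at hz
  exact hξ z hz

/-- Sign replacement. -/
theorem gs_swap (g : ZMod 2 → Submodule K J) {a b : ZMod 2} {ξ : Module.Dual K J}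
    (hξ : ξ ∈ dualGrading g a) {z : J} (hz : z ∈ g b) (f : ZMod 2 → K) :
    f b * ξ z = f a * ξ z := by
  by_cases h : b = a
  · rw [h]
  · rw [dual_zero g hξ hz h]; simp

section
variable (g : ZMod 2 → Submodule K J) (hg : DirectSum.IsInternal g) {n : ℕ}
    (x y : Fin n → J) (p : Fin n → ZMod 2)
    (hx : ∀ i, x i ∈ g (p i)) (hy : ∀ i, y i ∈ g (p i))
    (hskew : SkewSol (K := K) x y p p)
    (T : Module.Dual K J →ₗ[K] J)
    (hT : ∀ a b : ZMod 2, ∀ us ∈ dualGrading g a, ∀ vs ∈ dualGrading g b,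
      us (T vs) = ∑ i, gsign K (b * p i) * us (x i) * vs (y i))

include hg hy hT in
theorem T_form (ξ : Module.Dual K J) : T ξ = ∑ i, (gsign K (p i) * ξ (y i)) • x i := by
  rw [← sub_eq_zero, ← Module.forall_dual_apply_eq_zero_iff K]
  intro u
  rw [map_sub, sub_eq_zero, map_sum]
  have key : ∀ a b, ∀ u ∈ dualGrading g a, ∀ ξ ∈ dualGrading g b,
      u (T ξ) = ∑ i, u ((gsign K (p i) * ξ (y i)) • x i) := by
    intro a b u hu ξ hξ
    rw [hT a b u hu ξ hξ]
    refine Finset.sum_congr rfl fun i _ => ?_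
    have := gs_swap g hξ (hy i) (fun e => gsign K (e * p i))
    simp only [gs_mul_self] at this
    rw [map_smul, this, smul_eq_mul]; ring
  obtain ⟨ξ0, h0, ξ1, h1, rfl⟩ := dual_decomp g hg ξ
  obtain ⟨u0, h2, u1, h3, rfl⟩ := dual_decomp g hg u
  have := key _ _ _ h2 _ h0
  have := key _ _ _ h2 _ h1
  have := key _ _ _ h3 _ h0
  have := key _ _ _ h3 _ h1
  simp_all only [map_add, LinearMap.add_apply, mul_add, add_smul, Finset.sum_add_distrib]

include hg hy hT hskew in
theorem T_form2 (ξ : Module.Dual K J) : T ξ = - ∑ i, ξ (x i) • y i := by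
  rw [← sub_eq_zero, ← Module.forall_dual_apply_eq_zero_iff K]
  intro u
  rw [map_sub, sub_eq_zero, T_form g hg x y p hy T hT]
  have := congrArg (ev2 ξ u) hskew
  simp only [map_sum, map_neg, map_smul, ev2_tmul, gs_mul_self, smul_eq_mul] at this ⊢
  rw [← this]
  exact Finset.sum_congr rfl fun i _ => by ring

include hg hy hT in
theorem T_form1 {b : ZMod 2} {ξ : Module.Dual K J} (hξ : ξ ∈ dualGrading g b) :
    T ξ = gsign K b • ∑ i, ξ (y i) • x i := by
  rw [T_form g hg x y p hy T hT, Finset.smul_sum]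
  refine Finset.sum_congr rfl fun i _ => ?_
  rw [gs_swap g hξ (hy i) (gsign K), mul_smul]

include hg hx hy hT in
theorem T_even {b : ZMod 2} {ξ : Module.Dual K J} (hξ : ξ ∈ dualGrading g b) : T ξ ∈ g b := by
  rw [T_form g hg x y p hy T hT]
  refine Submodule.sum_mem _ fun i _ => ?_
  by_cases h : p i = b
  · exact Submodule.smul_mem _ _ (h ▸ hx i)
  · rw [dual_zero g hξ (hy i) h]; simp

include hg hy hT hskew in
theorem T_skew {b : ZMod 2} (ξ : Module.Dual K J) {η : Module.Dual K J}
    (hη : η ∈ dualGrading g b) : ξ (T η) = - gsign K b * η (T ξ) := by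
  rw [T_form1 g hg x y p hy T hT hη, T_form2 g hg x y p hy hskew T hT ξ]
  simp only [map_smul, map_sum, map_neg, smul_eq_mul]
  simp only [mul_comm, neg_mul_neg]

include hg hx hy hT in
theorem T'_even (T' : J →ₗ[K] Module.Dual K J)
    (hT'T : ∀ ξ : Module.Dual K J, T' (T ξ) = ξ) (hTT' : ∀ z : J, T (T' z) = z)
    {b : ZMod 2} {z : J} (hz : z ∈ g b) : T' z ∈ dualGrading g b := by
  have hc : IsCompl (g 0) (g 1) :=
    (DirectSum.isInternal_submodule_iff_isCompl g (i := 0) (j := 1) (by decide)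
      (Set.eq_of_subset_of_subset (fun e _ => zm_cases e) (Set.subset_univ _))).1 hg
  have hd : Disjoint (g b) (g (b + 1)) := by
    revert b; intro b _; fin_cases b
    · exact hc.disjoint
    · exact hc.disjoint.symm
  have hdec : ∃ ξ0 ∈ dualGrading g b, ∃ ξ1 ∈ dualGrading g (b + 1), T' z = ξ0 + ξ1 := by
    obtain ⟨u, hu, v, hv, e⟩ := dual_decomp g hg (T' z)
    clear hd hz
    fin_cases b
    · exact ⟨u, hu, v, hv, e⟩
    · exact ⟨v, hv, u, hu, by rw [e, add_comm]⟩
  obtain ⟨u, hu, v, hv, e⟩ := hdec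
  have h1 : T v = z - T u := by
    rw [← hTT' z, e]; simp
  have h2 : T v = 0 := by
    refine Submodule.disjoint_def.1 hd _ ?_ (T_even g hg x y p hx hy T hT hv)
    rw [h1]; exact Submodule.sub_mem _ hz (T_even g hg x y p hx hy T hT hu)
  have h3 : v = 0 := by rw [← hT'T v, h2, map_zero]
  rw [e, h3, add_zero]; exact hu

def ybe (m : J →ₗ[K] J →ₗ[K] J) (γ : J →ₗ[K] J) (x y : Fin n → J) (p : Fin n → ZMod 2) :
    (J ⊗[K] J) ⊗[K] J :=
  (∑ l, ∑ l', gsign K (p l' * p l) • ((m (x l) (x l') ⊗ₜ[K] γ (y l)) ⊗ₜ[K] γ (y l')))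
    - (∑ l, ∑ l', (γ (x l) ⊗ₜ[K] m (y l) (x l')) ⊗ₜ[K] γ (y l'))
    + (∑ l, ∑ l', gsign K (p l' * p l) • ((γ (x l) ⊗ₜ[K] γ (x l')) ⊗ₜ[K] m (y l) (y l')))

include hg hx hy hT hskew in
theorem ev_ybe (m : J →ₗ[K] J →ₗ[K] J) (γ : J →ₗ[K] J) (hγ : EvenMap g γ) {a b c : ZMod 2}
    {ξ η ζ : Module.Dual K J} (hξ : ξ ∈ dualGrading g a)
    (hη : η ∈ dualGrading g b) (hζ : ζ ∈ dualGrading g c) :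
    ev3 ξ η ζ (ybe m γ x y p) =
      gsign K (b * c) * gsign K b * gsign K c * ξ (m (T (η ∘ₗ γ)) (T (ζ ∘ₗ γ)))
      + gsign K c * η (m (T (ξ ∘ₗ γ)) (T (ζ ∘ₗ γ)))
      + gsign K (a * b) * ζ (m (T (ξ ∘ₗ γ)) (T (η ∘ₗ γ))) := by
  have hcomp : ∀ {a} {ξ : Module.Dual K J}, ξ ∈ dualGrading g a → ξ ∘ₗ γ ∈ dualGrading g a :=
    fun h z hz => h _ (hγ _ z hz)
  have e1 : gsign K (b * c) * gsign K b * gsign K c * ξ (m (T (η ∘ₗ γ)) (T (ζ ∘ₗ γ)))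
      = ∑ l, ∑ l', gsign K (p l' * p l) * (ξ (m (x l) (x l')) * η (γ (y l)) * ζ (γ (y l'))) := by
    rw [T_form1 g hg x y p hy T hT (hcomp hη), T_form1 g hg x y p hy T hT (hcomp hζ)]
    simp only [map_smul, map_sum, LinearMap.smul_apply, LinearMap.sum_apply, smul_eq_mul,
      LinearMap.comp_apply]
    simp only [Finset.mul_sum]
    rw [Finset.sum_comm]
    refine Finset.sum_congr rfl fun l _ => Finset.sum_congr rfl fun l' _ => ?_
    have h1 := gs_swap g hη (hγ _ _ (hy l)) (fun e => gsign K (p l' * e))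
    have h2 := gs_swap g hζ (hγ _ _ (hy l')) (fun e => gsign K (e * b))
    rw [mul_comm b c]
    linear_combination (exp := 1) (-ξ (m (x l) (x l')) * ζ (γ (y l'))) * h1
      - ξ (m (x l) (x l')) * η (γ (y l)) * h2
      + gsign K (c * b) * (ξ (m (x l) (x l')) * η (γ (y l)) * ζ (γ (y l')))
        * (gsign K c * gsign K c * gs_sq (K := K) b + gs_sq (K := K) c)
  have e2 : gsign K c * η (m (T (ξ ∘ₗ γ)) (T (ζ ∘ₗ γ)))
      = - ∑ l, ∑ l', (ξ (γ (x l)) * η (m (y l) (x l')) * ζ (γ (y l'))) := by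
    rw [T_form2 g hg x y p hy hskew T hT, T_form1 g hg x y p hy T hT (hcomp hζ)]
    simp only [map_smul, map_sum, map_neg, LinearMap.neg_apply, LinearMap.smul_apply,
      LinearMap.sum_apply, smul_eq_mul, LinearMap.comp_apply]
    simp only [Finset.mul_sum, mul_neg, Finset.sum_neg_distrib]
    rw [Finset.sum_comm]
    congr 1
    refine Finset.sum_congr rfl fun l _ => Finset.sum_congr rfl fun l' _ => ?_
    linear_combination (exp := 1) (ξ (γ (x l)) * η (m (y l) (x l')) * ζ (γ (y l')))
      * gs_sq (K := K) c
  have e3 : gsign K (a * b) * ζ (m (T (ξ ∘ₗ γ)) (T (η ∘ₗ γ)))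
      = ∑ l, ∑ l', gsign K (p l' * p l) * (ξ (γ (x l)) * η (γ (x l')) * ζ (m (y l) (y l'))) := by
    rw [T_form2 g hg x y p hy hskew T hT, T_form2 g hg x y p hy hskew T hT]
    simp only [map_smul, map_sum, map_neg, LinearMap.neg_apply, LinearMap.smul_apply,
      LinearMap.sum_apply, smul_eq_mul, LinearMap.comp_apply, neg_neg, Finset.mul_sum,
      mul_neg, Finset.sum_neg_distrib]
    rw [Finset.sum_comm]
    refine Finset.sum_congr rfl fun l _ => Finset.sum_congr rfl fun l' _ => ?_
    have h1 := gs_swap g hξ (hγ _ _ (hx l)) (fun e => gsign K (p l' * e))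
    have h2 := gs_swap g hη (hγ _ _ (hx l')) (fun e => gsign K (e * a))
    rw [mul_comm a b]
    linear_combination (exp := 1) (-η (γ (x l')) * ζ (m (y l) (y l'))) * h1
      - ξ (γ (x l)) * ζ (m (y l) (y l')) * h2
  rw [e1, e2, e3]
  simp only [ybe, map_add, map_sub, map_sum, map_smul, ev3_tmul, smul_eq_mul]
  ring
end

/-- a nondegenerate super skew-symmetric even `r ∈ J ⊗ J` solves the
super Hom-Jordan Yang-Baxter equation and satisfies `(α⊗α)(r) = r` iff the bilinear
form `B(x,y) = ⟨T_r⁻¹(x), y⟩` is symplectic. -/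
theorem skewYBE_iff_symplectic [FiniteDimensional K J]
    (g : ZMod 2 → Submodule K J) (hg : DirectSum.IsInternal g)
    (m : J →ₗ[K] J →ₗ[K] J) (α : J ≃ₗ[K] J)
    (hJ : IsMultHomJordan g m α.toLinearMap)
    (n : ℕ) (x y : Fin n → J) (p q : Fin n → ZMod 2)
    (hx : ∀ i, x i ∈ g (p i)) (hy : ∀ i, y i ∈ g (q i))
    (heven : ∀ i, p i + q i = 0)
    (hskew : SkewSol (K := K) x y p q)
    (T : Module.Dual K J →ₗ[K] J)
    (hT : ∀ a b : ZMod 2, ∀ us ∈ dualGrading g a, ∀ vs ∈ dualGrading g b,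
      us (T vs) = ∑ i, gsign K (b * p i) * us (x i) * vs (y i))
    (T' : J →ₗ[K] Module.Dual K J)
    (hT'T : ∀ ξ : Module.Dual K J, T' (T ξ) = ξ) (hTT' : ∀ z : J, T (T' z) = z) :
    (YBESol (K := K) m α.toLinearMap x y p q ∧
      (∑ i, α (x i) ⊗ₜ[K] α (y i)) = (∑ i, x i ⊗ₜ[K] y i)) ↔
    ((∀ a b : J, T' (α a) (α b) = T' a b) ∧
     (∀ px py pz : ZMod 2, ∀ a ∈ g px, ∀ b ∈ g py, ∀ d ∈ g pz,
        T' (m a b) (α d)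
          = T' (α a) (m b d) + gsign K (px * (py + pz)) * T' (α b) (m d a))) := by
  obtain rfl : p = q := by
    funext i
    have h := heven i
    generalize p i = a at h; generalize q i = b at h
    revert a b; decide
  obtain ⟨⟨hm, hα, hcomm, -⟩, hmult⟩ := hJ
  have hTe := fun {b : ZMod 2} {ξ : Module.Dual K J} (h : ξ ∈ dualGrading g b) =>
    T_even g hg x y p hx hy T hT h
  have hT'e := fun {b : ZMod 2} {z : J} (h : z ∈ g b) =>
    T'_even g hg x y p hx hy T hT T' hT'T hTT' h
  have hcomp : ∀ {a} {ξ : Module.Dual K J}, ξ ∈ dualGrading g a →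
      ξ ∘ₗ α.toLinearMap ∈ dualGrading g a := fun h z hz => h _ (hα _ z hz)
  -- the alpha condition
  have hA : ((∑ i, α (x i) ⊗ₜ[K] α (y i)) = (∑ i, x i ⊗ₜ[K] y i)) ↔
      ∀ ξ : Module.Dual K J, α (T (ξ ∘ₗ α.toLinearMap)) = T ξ := by
    have h2 := T_form2 g hg x y p hy hskew T hT
    constructor
    · intro h ξ
      rw [← sub_eq_zero, ← Module.forall_dual_apply_eq_zero_iff K]
      intro u
      rw [map_sub, sub_eq_zero, h2, h2]
      have := congrArg (ev2 ξ u) h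
      simp only [map_sum, ev2_tmul] at this
      simp only [map_neg, map_sum, map_smul, smul_eq_mul, LinearMap.comp_apply,
        LinearEquiv.coe_coe]
      rw [this]
    · intro h
      rw [← sub_eq_zero]
      apply ev2_sep
      intro ξ u
      have := congrArg u (h ξ)
      rw [h2, h2] at this
      simp only [map_neg, map_sum, map_smul, smul_eq_mul, LinearMap.comp_apply,
        LinearEquiv.coe_coe, neg_inj] at this
      simp only [map_sub, map_sum, ev2_tmul]
      rw [this, sub_self]
  have hB : (∀ ξ : Module.Dual K J, α (T (ξ ∘ₗ α.toLinearMap)) = T ξ) ↔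
      ∀ a b : J, T' (α a) (α b) = T' a b := by
    constructor
    · intro h a b
      have h1 := h (T' (α a))
      rw [hTT'] at h1
      have h2 := congrArg T' (α.injective h1)
      rw [hT'T] at h2
      rw [← h2]; rfl
    · intro h ξ
      have h1 : ξ ∘ₗ α.toLinearMap = T' (α.symm (T ξ)) := by
        ext b
        rw [← h, LinearEquiv.apply_symm_apply, hT'T]; rfl
      rw [h1, hTT', LinearEquiv.apply_symm_apply]
  have hY : YBESol (K := K) m α.toLinearMap x y p p ↔ ybe m α.toLinearMap x y p = 0 := Iff.rfl
  rw [hA, hB, and_comm, hY]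
  refine and_congr_right fun hiso => ?_
  have hiso' := hB.2 hiso
  have hskB : ∀ {c : ZMod 2} {w : J} (z : J), w ∈ g c → T' w z = - gsign K c * T' z w := by
    intro c w z hw
    have := T_skew g hg x y p hy hskew T hT (T' z) (hT'e hw)
    rw [hTT', hTT'] at this
    rw [this]
    linear_combination (-(T' w z)) * gs_sq (K := K) c
  -- key identity for homogeneous elements
  have key : ∀ a b c : ZMod 2, ∀ u ∈ g a, ∀ v ∈ g b, ∀ w ∈ g c,
      (ev3 (T' (α u)) (T' (α v)) (T' (α w)) (ybe m α.toLinearMap x y p) = 0 ↔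
        T' (m u v) (α w)
          = T' (α u) (m v w) + gsign K (a * (b + c)) * T' (α v) (m w u)) := by
    intro a b c u hu v hv w hw
    have hr : ∀ u, T (T' (α u) ∘ₗ α.toLinearMap) = u := by
      intro u
      apply α.injective
      rw [hiso', hTT']
    have hαu := hα _ _ hu
    have hαv := hα _ _ hv
    have hαw := hα _ _ hw
    simp only [LinearEquiv.coe_coe] at hαu hαv hαw
    rw [ev_ybe g hg x y p hx hy hskew T hT m α.toLinearMap hα (hT'e hαu) (hT'e hαv) (hT'e hαw),
      hr, hr, hr, hskB (m u v) hαw, hcomm _ _ _ hu _ hw, map_smul, smul_eq_mul]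
    by_cases habc : c = a + b
    · generalize T' (m u v) (α w) = X
      generalize T' (α u) (m v w) = Y
      generalize T' (α v) (m w u) = Z
      subst habc
      clear hu hv hw hαu hαv hαw
      have e0 : gsign K 0 = 1 := by simp [gsign]
      have e1 : gsign K 1 = -1 := by
        have : (1 : ZMod 2).val = 1 := rfl
        simp [gsign, this]
      have e2 : (1 : ZMod 2) + 1 = 0 := rfl
      have ha : a = 0 ∨ a = 1 := by revert a; decide
      have hb : b = 0 ∨ b = 1 := by revert b; decide
      rcases ha with rfl | rfl <;> rcases hb with rfl | rfl <;>
        simp only [e0, e1, e2, mul_zero, zero_mul, mul_one, one_mul, add_zero, zero_add] <;>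
        constructor <;> intro h <;>
        first
        | linear_combination (exp := 1) (-1 : K) * h
        | linear_combination (exp := 1) h
    · have z1 : T' (m u v) (α w) = 0 := dual_zero g (hT'e (hm _ _ _ hu _ hv)) hαw habc
      have z2 : T' (α u) (m v w) = 0 := dual_zero g (hT'e hαu) (hm _ _ _ hv _ hw)
        (by revert habc; clear * -; revert a b c; decide)
      have z3 : T' (α v) (m w u) = 0 := dual_zero g (hT'e hαv) (hm _ _ _ hw _ hu)
        (by revert habc; clear * -; revert a b c; decide)
      rw [z1, z2, z3]; simp
  constructor
  · intro h a b c u hu v hv w hw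
    rw [← key a b c u hu v hv w hw, h, map_zero]
  · intro h
    apply ev3_sep_hom g hg
    intro a b c ξ hξ η hη ζ hζ
    have hr : ∀ ξ, T' (α (T (ξ ∘ₗ α.toLinearMap))) = ξ := by
      intro ξ; rw [hiso', hT'T]
    have hu := hTe (hcomp hξ)
    have hv := hTe (hcomp hη)
    have hw := hTe (hcomp hζ)
    have := (key a b c _ hu _ hv _ hw).2 (h a b c _ hu _ hv _ hw)
    rwa [hr, hr, hr] at this
end
end

section
/- Let (A, ≺, ≻, α) be a multiplicative Hom-dendriform superalgebra. Then the product x ∘ y = x ≻ y + (-1)^{|x||y|} y ≺ x (on homogeneous elements) defines a Hom-pre-Jordan superalgebra structure (A, ∘, α). -/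
open scoped TensorProduct

noncomputable section

variable {K : Type*} [Field K] [CharZero K]
variable {J V : Type*} [AddCommGroup J] [Module K J] [AddCommGroup V] [Module K V]

theorem gsign_add' (e f : ZMod 2) : gsign K (e + f) = gsign K e * gsign K f := by
  have h : ∀ e : ZMod 2, e = 0 ∨ e = 1 := by decide
  have h1 : ((1 : ZMod 2) + 1) = 0 := by decide
  have h2 : (1 : ZMod 2).val = 1 := rfl
  rcases h e with rfl | rfl <;> rcases h f with rfl | rfl <;> simp [gsign, h1, h2]

theorem gsign_cases' (e : ZMod 2) : gsign K e = 1 ∨ gsign K e = -1 := by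
  have h : ∀ e : ZMod 2, e = 0 ∨ e = 1 := by decide
  have h2 : (1 : ZMod 2).val = 1 := rfl
  rcases h e with rfl | rfl <;> simp [gsign, h2]

set_option maxHeartbeats 4000000

/-- a multiplicative Hom-dendriform superalgebra `(A, ≺, ≻, α)` gives a
Hom-pre-Jordan superalgebra via `x ∘ y = x ≻ y + (-1)^{|x||y|} y ≺ x`. -/
theorem homDendriform_to_homPreJordan (g : ZMod 2 → Submodule K J)
    (hg : DirectSum.IsInternal g)
    (p s : J →ₗ[K] J →ₗ[K] J) (α : J →ₗ[K] J)
    (hD : IsHomDendriform g p s α)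
    (c : J →ₗ[K] J →ₗ[K] J)
    (hc : ∀ i j : ZMod 2, ∀ x ∈ g i, ∀ y ∈ g j,
      c x y = s x y + gsign K (i * j) • p y x) :
    IsHomPreJordan g c α := by
  obtain ⟨hp, hs, hα, mp, ms, d1, d2, d3⟩ := hD
  have hcE : EvenBilin g c := by
    intro i j x hx y hy
    rw [hc i j x hx y hy]
    refine Submodule.add_mem _ (hs i j x hx y hy) (Submodule.smul_mem _ _ ?_)
    rw [add_comm]
    exact hp j i y hy x hx
  have hind : ∀ (P : J → Prop), (∀ i, ∀ x ∈ g i, P x) → P 0 →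
      (∀ x y, P x → P y → P (x + y)) → ∀ x, P x := by
    intro P h1 h0 ha x
    have hx : x ∈ iSup g := by
      rw [hg.submodule_iSup_eq_top]; trivial
    exact Submodule.iSup_induction g (motive := P) hx h1 h0 ha
  have hcM : IsMult c α := by
    intro x y
    refine hind (fun x => α (c x y) = c (α x) (α y)) ?_ (by simp) ?_ x
    · intro i x hx
      refine hind (fun y => α (c x y) = c (α x) (α y)) ?_ (by simp) ?_ y
      · intro j y hy
        show α (c x y) = c (α x) (α y)
        rw [hc i j x hx y hy, hc i j _ (hα i x hx) _ (hα j y hy)]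
        simp [mp y x, ms x y]
      · intro y y' h h'
        simp only [map_add, h, h']
    · intro x x' h h'
      simp only [map_add, LinearMap.add_apply, h, h']
  obtain ⟨M, hM⟩ : ∃ M : J →ₗ[K] J →ₗ[K] J, ∀ x y, M x y = p x y + s x y :=
    ⟨p + s, fun _ _ => rfl⟩
  have hME : EvenBilin g M := by
    intro i j x hx y hy
    rw [hM]
    exact Submodule.add_mem _ (hp i j x hx y hy) (hs i j x hx y hy)
  have mM : ∀ x y, α (M x y) = M (α x) (α y) := by
    intro x y; simp [hM, mp x, ms x]
  have e1 : ∀ x y z, s (α x) (s y z) = s (M x y) (α z) := by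
    intro x y z; rw [d1, hM]
  have e2 : ∀ x y z, p (p x y) (α z) = p (α x) (M y z) := by
    intro x y z; rw [d2, hM]
  have e4 : ∀ x y z, M (M x y) (α z) = M (α x) (M y z) := by
    intro x y z
    have h1 := d1 x y z
    have h2 := d2 x y z
    have h3 := d3 x y z
    simp only [hM, map_add, LinearMap.add_apply] at *
    rw [h1, h2, ← h3]; abel
  have f1 : ∀ x y z u, s (M (α x) (α y)) (s (α z) (α u)) = s (M (α x) (M y z)) (α (α u)) := by
    intro x y z u; rw [← mM, e1, e4]
  have f2 : ∀ x y z u, p (s (α z) (α u)) (M (α x) (α y)) = s (α (α z)) (p (α u) (M x y)) := by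
    intro x y z u; rw [← mM, d3]
  have f3 : ∀ x y z u, p (p (α u) (α z)) (M (α x) (α y)) = p (α (α u)) (M (α z) (M x y)) := by
    intro x y z u; rw [← mM, e2]
  have hS : ∀ i j, ∀ x ∈ g i, ∀ y ∈ g j, sMul c i j x y = M x y + gsign K (i * j) • M y x := by
    intro i j x hx y hy
    rw [sMul, hc i j x hx y hy, hc j i y hy x hx, hM, hM, mul_comm j i]
    rcases gsign_cases' (K := K) (i * j) with h | h <;> rw [h] <;> module
  have hSE : ∀ i j, ∀ x ∈ g i, ∀ y ∈ g j, sMul c i j x y ∈ g (i + j) := by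
    intro i j x hx y hy
    rw [hS i j x hx y hy]
    refine Submodule.add_mem _ (hME i j x hx y hy) (Submodule.smul_mem _ _ ?_)
    rw [add_comm]
    exact hME j i y hy x hx
  -- the three shapes of degree-four terms
  have A : ∀ px py pz pu : ZMod 2, ∀ x ∈ g px, ∀ y ∈ g py, ∀ z ∈ g pz, ∀ u ∈ g pu,
      c (sMul c px py (α x) (α y)) (c (α z) (α u)) =
        s (sMul c px py (α x) (α y)) (s (α z) (α u) + gsign K (pz * pu) • p (α u) (α z))
        + gsign K ((px + py) * (pz + pu)) •
          p (s (α z) (α u) + gsign K (pz * pu) • p (α u) (α z)) (sMul c px py (α x) (α y)) := by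
    intro px py pz pu x hx y hy z hz u hu
    have hx' := hα _ _ hx
    have hy' := hα _ _ hy
    have hz' := hα _ _ hz
    have hu' := hα _ _ hu
    rw [hc (px + py) (pz + pu) _ (hSE _ _ _ hx' _ hy') _ (hcE _ _ _ hz' _ hu'),
      hc pz pu _ hz' _ hu']
  have B : ∀ px py pz pu : ZMod 2, ∀ x ∈ g px, ∀ y ∈ g py, ∀ z ∈ g pz, ∀ u ∈ g pu,
      c (α (α x)) (c (sMul c py pz y z) (α u)) =
        s (α (α x)) (s (sMul c py pz y z) (α u)
          + gsign K ((py + pz) * pu) • p (α u) (sMul c py pz y z))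
        + gsign K (px * (py + pz + pu)) •
          p (s (sMul c py pz y z) (α u)
            + gsign K ((py + pz) * pu) • p (α u) (sMul c py pz y z)) (α (α x)) := by
    intro px py pz pu x hx y hy z hz u hu
    have hx' := hα _ _ (hα _ _ hx)
    have hu' := hα _ _ hu
    have hS' := hSE _ _ _ hy _ hz
    rw [hc px (py + pz + pu) _ hx' _ (hcE _ _ _ hS' _ hu'), hc (py + pz) pu _ hS' _ hu']
  have C : ∀ px py pz pu : ZMod 2, ∀ x ∈ g px, ∀ y ∈ g py, ∀ z ∈ g pz, ∀ u ∈ g pu,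
      c (α (α x)) (c (α y) (c z u)) =
        s (α (α x)) (s (α y) (s z u + gsign K (pz * pu) • p u z)
          + gsign K (py * (pz + pu)) • p (s z u + gsign K (pz * pu) • p u z) (α y))
        + gsign K (px * (py + (pz + pu))) •
          p (s (α y) (s z u + gsign K (pz * pu) • p u z)
          + gsign K (py * (pz + pu)) • p (s z u + gsign K (pz * pu) • p u z) (α y)) (α (α x)) := by
    intro px py pz pu x hx y hy z hz u hu
    have hx' := hα _ _ (hα _ _ hx)
    have hy' := hα _ _ hy
    have h1 := hcE _ _ _ hz _ hu
    have h2 := hcE _ _ _ hy' _ h1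
    rw [hc _ _ _ hx' _ h2, hc _ _ _ hy' _ h1, hc _ _ _ hz _ hu]
  have D : ∀ px py pz pu : ZMod 2, ∀ x ∈ g px, ∀ y ∈ g py, ∀ z ∈ g pz, ∀ u ∈ g pu,
      c (sMul c (px + pz) py (sMul c px pz x z) (α y)) (α (α u)) =
        s (M (sMul c px pz x z) (α y) + gsign K ((px + pz) * py) • M (α y) (sMul c px pz x z))
          (α (α u))
        + gsign K ((px + pz + py) * pu) • p (α (α u))
          (M (sMul c px pz x z) (α y)
            + gsign K ((px + pz) * py) • M (α y) (sMul c px pz x z)) := by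
    intro px py pz pu x hx y hy z hz u hu
    have hu' := hα _ _ (hα _ _ hu)
    have hy' := hα _ _ hy
    have h1 := hSE _ _ _ hx _ hz
    rw [hc _ _ _ (hSE _ _ _ h1 _ hy') _ hu', hS _ _ _ h1 _ hy']
  refine ⟨hcE, hα, hcM, ?_, ?_⟩
  · intro px py pz pu x hx y hy z hz u hu
    have hx' := hα _ _ hx
    have hy' := hα _ _ hy
    have hz' := hα _ _ hz
    rw [A px py pz pu x hx y hy z hz u hu, A py pz px pu y hy z hz x hx u hu,
      A pz px py pu z hz x hx y hy u hu, B px py pz pu x hx y hy z hz u hu,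
      B py pz px pu y hy z hz x hx u hu, B pz px py pu z hz x hx y hy u hu,
      hS _ _ _ hx' _ hy', hS _ _ _ hy' _ hz', hS _ _ _ hz' _ hx',
      hS _ _ _ hx _ hy, hS _ _ _ hy _ hz, hS _ _ _ hz _ hx]
    rw [mul_comm pz px]
    simp only [map_add, map_smul, LinearMap.add_apply, LinearMap.smul_apply, e1, e2, d3, e4,
      f1, f2, f3, mM, mp _, ms _, mul_add, add_mul, gsign_add']
    rw [mul_comm py px, mul_comm pz px, mul_comm pz py]
    have q1 := gsign_cases' (K := K) (px * py)
    have q2 := gsign_cases' (K := K) (px * pz)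
    have q3 := gsign_cases' (K := K) (py * pz)
    have q4 := gsign_cases' (K := K) (px * pu)
    have q5 := gsign_cases' (K := K) (py * pu)
    have q6 := gsign_cases' (K := K) (pz * pu)
    generalize gsign K (px * py) = a1 at *
    generalize gsign K (px * pz) = a2 at *
    generalize gsign K (py * pz) = a3 at *
    generalize gsign K (px * pu) = a4 at *
    generalize gsign K (py * pu) = a5 at *
    generalize gsign K (pz * pu) = a6 at *
    have r1 : a1 * a1 = 1 := by rcases q1 with h | h <;> simp [h]
    have r2 : a2 * a2 = 1 := by rcases q2 with h | h <;> simp [h]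
    have r3 : a3 * a3 = 1 := by rcases q3 with h | h <;> simp [h]
    have r4 : a4 * a4 = 1 := by rcases q4 with h | h <;> simp [h]
    have r5 : a5 * a5 = 1 := by rcases q5 with h | h <;> simp [h]
    have r6 : a6 * a6 = 1 := by rcases q6 with h | h <;> simp [h]
    clear q1 q2 q3 q4 q5 q6
    match_scalars <;> grind
  · intro px py pz pu x hx y hy z hz u hu
    rw [C px py pz pu x hx y hy z hz u hu, C pz py px pu z hz y hy x hx u hu,
      D px py pz pu x hx y hy z hz u hu, B px py pz pu x hx y hy z hz u hu,
      B py pz px pu y hy z hz x hx u hu, B pz px py pu z hz x hx y hy u hu,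
      hS _ _ _ hx _ hz,
      hS _ _ _ hx _ hy, hS _ _ _ hy _ hz, hS _ _ _ hz _ hx]
    simp only [map_add, map_smul, LinearMap.add_apply, LinearMap.smul_apply, e1, e2, d3, e4,
      f1, f2, f3, mM, mp _, ms _, mul_add, add_mul, gsign_add']
    rw [mul_comm py px, mul_comm pz px, mul_comm pz py]
    have q1 := gsign_cases' (K := K) (px * py)
    have q2 := gsign_cases' (K := K) (px * pz)
    have q3 := gsign_cases' (K := K) (py * pz)
    have q4 := gsign_cases' (K := K) (px * pu)
    have q5 := gsign_cases' (K := K) (py * pu)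
    have q6 := gsign_cases' (K := K) (pz * pu)
    generalize gsign K (px * py) = a1 at *
    generalize gsign K (px * pz) = a2 at *
    generalize gsign K (py * pz) = a3 at *
    generalize gsign K (px * pu) = a4 at *
    generalize gsign K (py * pu) = a5 at *
    generalize gsign K (pz * pu) = a6 at *
    have r1 : a1 * a1 = 1 := by rcases q1 with h | h <;> simp [h]
    have r2 : a2 * a2 = 1 := by rcases q2 with h | h <;> simp [h]
    have r3 : a3 * a3 = 1 := by rcases q3 with h | h <;> simp [h]
    have r4 : a4 * a4 = 1 := by rcases q4 with h | h <;> simp [h]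
    have r5 : a5 * a5 = 1 := by rcases q5 with h | h <;> simp [h]
    have r6 : a6 * a6 = 1 := by rcases q6 with h | h <;> simp [h]
    clear q1 q2 q3 q4 q5 q6
    match_scalars <;> grind
end
end

section
/- Let (A, ∘, α) be a multiplicative Hom-pre-Jordan superalgebra. Then the product x · y = x ∘ y + (-1)^{|x||y|} y ∘ x (on homogeneous elements) defines a multiplicative Hom-Jordan superalgebra (A, ·, α), called the associated Hom-Jordan superalgebra of (A, ∘, α). -/
open scoped TensorProduct

noncomputable section

variable {K : Type*} [Field K] [CharZero K]
variable {J V : Type*} [AddCommGroup J] [Module K J] [AddCommGroup V] [Module K V]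

set_option maxHeartbeats 4000000 in
/-- the product `x · y = x ∘ y + (-1)^{|x||y|} y ∘ x` on a multiplicative
Hom-pre-Jordan superalgebra defines a multiplicative Hom-Jordan superalgebra. -/
theorem homPreJordan_to_homJordan (g : ZMod 2 → Submodule K J)
    (hg : DirectSum.IsInternal g)
    (c : J →ₗ[K] J →ₗ[K] J) (α : J →ₗ[K] J)
    (hpre : IsHomPreJordan g c α)
    (m : J →ₗ[K] J →ₗ[K] J)
    (hm : ∀ i j : ZMod 2, ∀ x ∈ g i, ∀ y ∈ g j,
      m x y = c x y + gsign K (i * j) • c y x) :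
    IsMultHomJordan g m α := by
  obtain ⟨hc, hα, hmul, h1, h2⟩ := hpre
  have me : EvenBilin g m := by
    intro i j x hx y hy
    rw [hm i j x hx y hy]
    refine Submodule.add_mem _ (hc i j x hx y hy) (Submodule.smul_mem _ _ ?_)
    rw [add_comm]; exact hc j i y hy x hx
  have g0 : gsign K 0 = 1 := by simp [gsign]
  have g1 : gsign K 1 = -1 := by simp [gsign, ZMod.val_one]
  have gsq : ∀ i : ZMod 2, gsign K i * gsign K i = 1 := by
    intro i; fin_cases i
    · change gsign K 0 * gsign K 0 = 1; rw [g0]; ring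
    · change gsign K 1 * gsign K 1 = 1; rw [g1]; ring
  have mmul : IsMult m α := by
    have top : ∀ x : J, x ∈ ⨆ i, g i := by
      intro x; rw [hg.submodule_iSup_eq_top]; trivial
    intro x y
    refine Submodule.iSup_induction g (motive := fun x => α (m x y) = m (α x) (α y)) (top x)
      ?_ (by simp) (by intro a b ha hb; simp [ha, hb])
    intro i x hx
    refine Submodule.iSup_induction g (motive := fun y => α (m x y) = m (α x) (α y)) (top y)
      ?_ (by simp) (by intro a b ha hb; simp [ha, hb])
    intro j y hy
    rw [hm i j x hx y hy, hm i j _ (hα i x hx) _ (hα j y hy), map_add, map_smul, hmul, hmul]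
  refine ⟨⟨me, hα, ?_, ?_⟩, mmul⟩
  · intro i j x hx y hy
    rw [hm i j x hx y hy, hm j i y hy x hx, mul_comm j i, smul_add, smul_smul, gsq, one_smul,
      add_comm]
  have key : ∀ px py pz pu : ZMod 2, ∀ x ∈ g px, ∀ y ∈ g py, ∀ z ∈ g pz, ∀ u ∈ g pu,
      hAss m α (m x y) (α z) (α u) =
        sMul c (px + py + pz) pu (sMul c (px + py) pz (sMul c px py x y) (α z)) (α (α u))
        - sMul c (px + py) (pz + pu) (sMul c px py (α x) (α y)) (sMul c pz pu (α z) (α u)) := by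
    intro px py pz pu x hx y hy z hz u hu
    have e1 := me _ _ _ hx _ hy
    have e2 := me _ _ _ e1 _ (hα _ _ hz)
    have e3 := me _ _ _ (hα _ _ hx) _ (hα _ _ hy)
    have e4 := me _ _ _ (hα _ _ hz) _ (hα _ _ hu)
    unfold hAss sMul
    rw [mmul x y, hm _ _ _ e2 _ (hα _ _ (hα _ _ hu)), hm _ _ _ e3 _ e4,
      hm _ _ _ e1 _ (hα _ _ hz), hm _ _ _ hx _ hy, hm _ _ _ (hα _ _ hx) _ (hα _ _ hy),
      hm _ _ _ (hα _ _ hz) _ (hα _ _ hu)]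
  intro px py pz pu x hx y hy z hz u hu
  rw [key px py pz pu x hx y hy z hz u hu, key py pu pz px y hy u hu z hz x hx,
    key pu px pz py u hu x hx z hz y hy]
  have A := h1 px py pu pz x hx y hy u hu z hz
  have B1 := (h2 px pz py pu x hx z hz y hy u hu).trans (h1 px pz py pu x hx z hz y hy u hu).symm
  have B2 := (h2 py pz pu px y hy z hz u hu x hx).trans (h1 py pz pu px y hy z hz u hu x hx).symm
  have B3 := (h2 pu pz px py u hu z hz x hx y hy).trans (h1 pu pz px py u hu z hz x hx y hy).symm
  replace A := congrArg (fun w => gsign K (pu * px) • w) A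
  replace B1 := congrArg (fun w => gsign K (pu * (px + pz)) • gsign K (pz * py) • w) B1
  replace B2 := congrArg (fun w => gsign K (px * (py + pz)) • gsign K (pz * pu) • w) B2
  replace B3 := congrArg (fun w => gsign K (py * (pu + pz)) • gsign K (pz * px) • w) B3
  clear h1 h2 key hm me mmul hmul hc hα hg hx hy hz hu
  have z2 : (1 : ZMod 2) + 1 = 0 := by decide
  have cs : ∀ i : ZMod 2, i = 0 ∨ i = 1 := by decide
  simp only [sMul, map_add, map_smul, LinearMap.add_apply, LinearMap.smul_apply] at *
  rcases cs px with rfl | rfl <;> rcases cs py with rfl | rfl <;> rcases cs pz with rfl | rfl <;>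
    rcases cs pu with rfl | rfl <;>
    simp only [z2, add_zero, zero_add, mul_zero, mul_one, g0, g1] at A B1 B2 B3 ⊢
  all_goals linear_combination (norm := module) B1 + B2 + B3 - A
end
end

section
/- Let (J, ·, α) be a multiplicative Hom-Jordan superalgebra, (V, π, β) a representation, and T : V → J an O-operator of J associated to (V, π, β). Then (V, ⋆, β) is a Hom-pre-Jordan superalgebra, where u ⋆ v = π(T(u))v for homogeneous u, v ∈ V. Consequently, V carries the associated Hom-Jordan superalgebra structure u • v = u ⋆ v + (-1)^{|u||v|} v ⋆ u, T is a homomorphism of Hom-Jordan superalgebras from (V, •, β) to (J, ·, α), and T(V) ⊂ J carries an induced Hom-pre-Jordan superalgebra structure determined by T(u) ∘ T(v) = T(u ⋆ v). -/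
open scoped TensorProduct

noncomputable section

variable {K : Type*} [Field K] [CharZero K]
variable {J V : Type*} [AddCommGroup J] [Module K J] [AddCommGroup V] [Module K V]

theorem gsign_zero' : gsign K 0 = 1 := by simp [gsign]

theorem gsign_one' : gsign K 1 = -1 := by
  have : (1 : ZMod 2).val = 1 := rfl
  simp [gsign, this]

theorem zmod2_cases (p : ZMod 2) : p = 0 ∨ p = 1 := by
  revert p; decide

theorem zmod2_oo : (1 : ZMod 2) + 1 = 0 := by decide

theorem exists_decomp (g : ZMod 2 → Submodule K J) (hg : DirectSum.IsInternal g) (x : J) :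
    ∃ a ∈ g 0, ∃ b ∈ g 1, x = a + b := by
  have h : x ∈ ⨆ i, g i := by rw [hg.submodule_iSup_eq_top]; trivial
  induction h using Submodule.iSup_induction' with
  | mem i x hx =>
    rcases zmod2_cases i with rfl | rfl
    · exact ⟨x, hx, 0, Submodule.zero_mem _, by simp⟩
    · exact ⟨0, Submodule.zero_mem _, x, hx, by simp⟩
  | zero => exact ⟨0, Submodule.zero_mem _, 0, Submodule.zero_mem _, by simp⟩
  | add x y _ _ hx hy =>
    obtain ⟨a, ha, b, hb, rfl⟩ := hx
    obtain ⟨c, hc, d, hd, rfl⟩ := hy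
    exact ⟨a + c, add_mem ha hc, b + d, add_mem hb hd, by abel⟩

theorem sMul_mem {g : ZMod 2 → Submodule K J} {c : J →ₗ[K] J →ₗ[K] J} (hc : EvenBilin g c)
    {i j : ZMod 2} {x y : J} (hx : x ∈ g i) (hy : y ∈ g j) : sMul c i j x y ∈ g (i + j) := by
  refine add_mem (hc i j x hx y hy) (Submodule.smul_mem _ _ ?_)
  rw [add_comm]; exact hc j i y hy x hx

set_option maxHeartbeats 4000000 in
theorem preJordan_to_jordan (g : ZMod 2 → Submodule K J) (hg : DirectSum.IsInternal g)
    (c m : J →ₗ[K] J →ₗ[K] J)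
    (α : J →ₗ[K] J) (h : IsHomPreJordan g c α)
    (hm : ∀ i j : ZMod 2, ∀ u ∈ g i, ∀ v ∈ g j, m u v = sMul c i j u v) :
    IsMultHomJordan g m α := by
  obtain ⟨hc, hα, hmul, h1, h2⟩ := h
  have hmm : ∀ i j : ZMod 2, ∀ u ∈ g i, ∀ v ∈ g j, m u v ∈ g (i + j) := by
    intro i j u hu v hv
    rw [hm i j u hu v hv]; exact sMul_mem hc hu hv
  refine ⟨⟨hmm, hα, ?_, ?_⟩, ?_⟩
  · intro i j x hx y hy
    rw [hm i j x hx y hy, hm j i y hy x hx]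
    simp only [sMul]
    rcases zmod2_cases i with rfl | rfl <;> rcases zmod2_cases j with rfl | rfl <;>
      simp only [gsign_zero', gsign_one', mul_zero, zero_mul, mul_one] <;> module
  · intro px py pz pu x hx y hy z hz u hu
    have key : ∀ px py pz pu : ZMod 2, ∀ x ∈ g px, ∀ y ∈ g py, ∀ z ∈ g pz, ∀ u ∈ g pu,
        hAss m α (m x y) (α z) (α u) =
          sMul c (px + py + pz) pu (sMul c (px + py) pz (sMul c px py x y) (α z)) (α (α u))
          - sMul c (px + py) (pz + pu) (α (sMul c px py x y)) (sMul c pz pu (α z) (α u)) := by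
      intro px py pz pu x hx y hy z hz u hu
      have e := sMul_mem hc hx hy
      have hz' := hα _ _ hz
      have hu' := hα _ _ hu
      rw [hAss, hm _ _ x hx y hy, hm _ _ _ e _ hz', hm _ _ _ hz' _ hu',
        hm _ _ _ (sMul_mem hc e hz') _ (hα _ _ hu'),
        hm _ _ _ (hα _ _ e) _ (sMul_mem hc hz' hu')]
    rw [key px py pz pu x hx y hy z hz u hu, key py pu pz px y hy u hu z hz x hx,
      key pu px pz py u hu x hx z hz y hy]
    have A := h1 px py pu pz x hx y hy u hu z hz
    have B1 := (h2 px pz py pu x hx z hz y hy u hu).trans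
      (h1 px pz py pu x hx z hz y hy u hu).symm
    have B2 := (h2 py pz pu px y hy z hz u hu x hx).trans
      (h1 py pz pu px y hy z hz u hu x hx).symm
    have B3 := (h2 pu pz px py u hu z hz x hx y hy).trans
      (h1 pu pz px py u hu z hz x hx y hy).symm
    clear h1 h2 key
    simp only [sMul, map_add, map_smul, LinearMap.add_apply, LinearMap.smul_apply,
      show ∀ x y, α (c x y) = c (α x) (α y) from hmul] at A B1 B2 B3 ⊢
    linear_combination (norm := skip) gsign K (pu * (px + pz) + pz * py) • B1
      + gsign K (px * (py + pz) + pz * pu) • B2 + gsign K (py * (pu + pz) + pz * px) • B3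
      - gsign K (px * pu) • A
    clear A B1 B2 B3
    rcases zmod2_cases px with rfl | rfl <;> rcases zmod2_cases py with rfl | rfl <;>
    rcases zmod2_cases pz with rfl | rfl <;> rcases zmod2_cases pu with rfl | rfl <;>
    simp only [gsign_zero', gsign_one', mul_zero, zero_mul, mul_one, add_zero, zero_add,
      zmod2_oo, one_smul, neg_smul] <;>
    module
  · have hom : ∀ i j : ZMod 2, ∀ u ∈ g i, ∀ v ∈ g j, α (m u v) = m (α u) (α v) := by
      intro i j u hu v hv
      rw [hm i j u hu v hv, hm i j _ (hα _ _ hu) _ (hα _ _ hv)]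
      simp only [sMul, map_add, map_smul, hmul u v, hmul v u]
    intro x y
    obtain ⟨a, ha, b, hb, rfl⟩ := exists_decomp g hg x
    obtain ⟨a', ha', b', hb', rfl⟩ := exists_decomp g hg y
    simp only [map_add, LinearMap.add_apply, hom _ _ _ ha _ ha', hom _ _ _ ha _ hb',
      hom _ _ _ hb _ ha', hom _ _ _ hb _ hb']

/-- an O-operator `T : V → J` of a multiplicative Hom-Jordan
superalgebra associated to `(V, π, β)` makes `(V, ⋆, β)` with `u ⋆ v = π(T(u))v` a
Hom-pre-Jordan superalgebra; `V` then carries the associated Hom-Jordan structure,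
`T` is a homomorphism of Hom-Jordan superalgebras, and `T(V)` carries an induced
Hom-pre-Jordan structure determined by `T(u) ∘ T(v) = T(u ⋆ v)`. -/
theorem oOperator_induces_homPreJordan (g : ZMod 2 → Submodule K J)
    (hg : DirectSum.IsInternal g)
    (m : J →ₗ[K] J →ₗ[K] J) (α : J →ₗ[K] J) (hJ : IsMultHomJordan g m α)
    (gV : ZMod 2 → Submodule K V) (hgV : DirectSum.IsInternal gV)
    (π : J →ₗ[K] Module.End K V) (β : Module.End K V)
    (hrep : IsRep g m α gV π β)
    (T : V →ₗ[K] J) (hT : IsOOperator g m α gV π β T)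
    (mV : V →ₗ[K] V →ₗ[K] V)
    (hmV : ∀ i j : ZMod 2, ∀ u ∈ gV i, ∀ v ∈ gV j,
      mV u v = π (T u) v + gsign K (i * j) • π (T v) u)
    (c' : LinearMap.range T →ₗ[K] LinearMap.range T →ₗ[K] LinearMap.range T)
    (hc' : ∀ u v : V,
      (c' ⟨T u, LinearMap.mem_range_self T u⟩ ⟨T v, LinearMap.mem_range_self T v⟩ : J)
        = T (π (T u) v))
    (α' : LinearMap.range T →ₗ[K] LinearMap.range T)
    (hα' : ∀ w : LinearMap.range T, (α' w : J) = α (w : J)) :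
    IsHomPreJordan gV (π.comp T) β ∧
    IsMultHomJordan gV mV β ∧
    (∀ i j : ZMod 2, ∀ u ∈ gV i, ∀ v ∈ gV j, T (mV u v) = m (T u) (T v)) ∧
    (∀ v : V, T (β v) = α (T v)) ∧
    IsHomPreJordan (fun i => (g i).comap (LinearMap.range T).subtype) c' α' := by
  obtain ⟨_, hmJ⟩ := hJ
  obtain ⟨hπ, hβ, hβπ, r1, r2⟩ := hrep
  obtain ⟨hT0, hTα, hTm⟩ := hT
  have hβπ' : ∀ (x : J) (v : V), β (π x v) = π (α x) (β v) := fun x v =>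
    LinearMap.congr_fun (hβπ x) v
  have hTs : ∀ i j : ZMod 2, ∀ u ∈ gV i, ∀ v ∈ gV j,
      T (sMul (π.comp T) i j u v) = m (T u) (T v) := fun i j u hu v hv =>
    (hTm i j u hu v hv).symm
  have hev : EvenBilin gV (π.comp T) := fun i j x hx y hy => hπ i j _ (hT0 _ _ hx) _ hy
  have hpre : IsHomPreJordan gV (π.comp T) β := by
    refine ⟨hev, hβ, ?_, ?_, ?_⟩
    · intro x y
      simp [hβπ', hTα]
    · intro px py pz pu x hx y hy z hz u hu
      have R := LinearMap.congr_fun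
        (r1 px py pz _ (hT0 _ _ hx) _ (hT0 _ _ hy) _ (hT0 _ _ hz)) u
      simp only [LinearMap.comp_apply, hTs _ _ _ (hβ _ _ hx) _ (hβ _ _ hy),
        hTs _ _ _ (hβ _ _ hy) _ (hβ _ _ hz), hTs _ _ _ (hβ _ _ hz) _ (hβ _ _ hx),
        hTs _ _ _ hx _ hy, hTs _ _ _ hy _ hz, hTs _ _ _ hz _ hx, ← hTα]
      simp only [LinearMap.add_apply, LinearMap.smul_apply, Module.End.mul_apply] at R
      linear_combination (norm := skip) gsign K (px * pz) • R
      clear R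
      rcases zmod2_cases px with rfl | rfl <;> rcases zmod2_cases py with rfl | rfl <;>
      rcases zmod2_cases pz with rfl | rfl <;>
      simp only [gsign_zero', gsign_one', mul_zero, zero_mul, mul_one, add_zero, zero_add,
        zmod2_oo, one_smul, neg_smul] <;>
      module
    · intro px py pz pu x hx y hy z hz u hu
      have R := LinearMap.congr_fun
        ((r2 px py pz _ (hT0 _ _ hx) _ (hT0 _ _ hy) _ (hT0 _ _ hz)).symm.trans
        (r1 px py pz _ (hT0 _ _ hx) _ (hT0 _ _ hy) _ (hT0 _ _ hz))) u
      simp only [LinearMap.comp_apply,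
        hTs _ _ _ (sMul_mem hev hx hz) _ (hβ _ _ hy), hTs _ _ _ hx _ hz,
        hTs _ _ _ hx _ hy, hTs _ _ _ hy _ hz, hTs _ _ _ hz _ hx, ← hTα]
      simp only [LinearMap.add_apply, LinearMap.smul_apply, Module.End.mul_apply] at R
      linear_combination (norm := skip) gsign K (px * pz) • R
      clear R
      rcases zmod2_cases px with rfl | rfl <;> rcases zmod2_cases py with rfl | rfl <;>
      rcases zmod2_cases pz with rfl | rfl <;>
      simp only [gsign_zero', gsign_one', mul_zero, zero_mul, mul_one, add_zero, zero_add,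
        zmod2_oo, one_smul, neg_smul] <;>
      module
  refine ⟨hpre, preJordan_to_jordan gV hgV _ mV β hpre hmV, ?_, fun v => (hTα v).symm, ?_⟩
  · intro i j u hu v hv
    rw [hmV i j u hu v hv, hTm i j u hu v hv]
  -- the image
  have lift : ∀ i : ZMod 2, ∀ w : LinearMap.range T,
      w ∈ (g i).comap (LinearMap.range T).subtype →
      ∃ v ∈ gV i, w = T.rangeRestrict v := by
    rintro i ⟨_, v, rfl⟩ hw
    have hw : T v ∈ g i := hw
    obtain ⟨a, ha, b, hb, rfl⟩ := exists_decomp gV hgV v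
    have hd : Disjoint (g 0) (g 1) :=
      hg.submodule_iSupIndep.pairwiseDisjoint (by decide : (0 : ZMod 2) ≠ 1)
    rw [Submodule.disjoint_def] at hd
    rw [map_add] at hw
    rcases zmod2_cases i with rfl | rfl
    · have h0 : T b = 0 := hd _ (((g 0).add_mem_iff_right (hT0 _ _ ha)).1 hw) (hT0 _ _ hb)
      exact ⟨a, ha, Subtype.ext (by simp [h0])⟩
    · have h0 : T a = 0 := hd _ (hT0 _ _ ha) (((g 1).add_mem_iff_left (hT0 _ _ hb)).1 hw)
      exact ⟨b, hb, Subtype.ext (by simp [h0])⟩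
  have hcR : ∀ u v : V, c' (T.rangeRestrict u) (T.rangeRestrict v)
      = T.rangeRestrict (π.comp T u v) := fun u v => Subtype.ext (hc' u v)
  have hαR : ∀ u : V, α' (T.rangeRestrict u) = T.rangeRestrict (β u) := fun u =>
    Subtype.ext ((hα' _).trans (hTα u))
  have hsR : ∀ (i j : ZMod 2) (u v : V), sMul c' i j (T.rangeRestrict u) (T.rangeRestrict v)
      = T.rangeRestrict (sMul (π.comp T) i j u v) := fun i j u v => by
    simp only [sMul, hcR, map_add, map_smul]
  obtain ⟨p1, p2, p3, p4, p5⟩ := hpre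
  refine ⟨?_, ?_, ?_, ?_, ?_⟩
  · intro i j x hx y hy
    obtain ⟨x, kx, rfl⟩ := lift _ _ hx
    obtain ⟨y, ky, rfl⟩ := lift _ _ hy
    rw [hcR]
    exact hT0 _ _ (p1 i j x kx y ky)
  · intro i x hx
    obtain ⟨x, kx, rfl⟩ := lift _ _ hx
    rw [hαR]
    exact hT0 _ _ (p2 i x kx)
  · intro x y
    obtain ⟨x, rfl⟩ := T.surjective_rangeRestrict x
    obtain ⟨y, rfl⟩ := T.surjective_rangeRestrict y
    rw [hcR, hαR, hαR, hαR, hcR, p3]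
  · intro px py pz pu x hx y hy z hz u hu
    obtain ⟨x, kx, rfl⟩ := lift _ _ hx
    obtain ⟨y, ky, rfl⟩ := lift _ _ hy
    obtain ⟨z, kz, rfl⟩ := lift _ _ hz
    obtain ⟨u, ku, rfl⟩ := lift _ _ hu
    simp only [hαR, hsR, hcR]
    have R := congrArg T.rangeRestrict (p4 px py pz pu x kx y ky z kz u ku)
    rw [map_add, map_add, map_add, map_add, map_smul, map_smul, map_smul, map_smul] at R
    exact R
  · intro px py pz pu x hx y hy z hz u hu
    obtain ⟨x, kx, rfl⟩ := lift _ _ hx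
    obtain ⟨y, ky, rfl⟩ := lift _ _ hy
    obtain ⟨z, kz, rfl⟩ := lift _ _ hz
    obtain ⟨u, ku, rfl⟩ := lift _ _ hu
    simp only [hαR, hsR, hcR]
    have R := congrArg T.rangeRestrict (p5 px py pz pu x kx y ky z kz u ku)
    rw [map_add, map_add, map_add, map_add, map_smul, map_smul, map_smul, map_smul] at R
    exact R
end
end
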